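/- arXiv:1904.03503 — 3 statements merged into one kernel-verified Lean document; each statement's English description precedes it below -/
import Mathlib

section
/- Let L be a number field of degree g = [L:ℚ], Γ an order of L with conductor f, K ⊆ L a subfield with ring of integers O_K, n = [L:K], and R = M_n(O_K). Let t be the number of ring homomorphisms K → L and h(Γ) = |Pic(Γ)| the cardinality of the Picard (class) group of the domain Γ. Then the number of Γ-structures on R is at most N(f)^g · h(Γ) · t. -/
open NumberField

/-- Two unital ring homomorphisms `A → B` are conjugate if they differ by conjugation
by a unit of `B`.  A `Γ`-structure on `B` is an equivalence class for this relation. -/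
def ConjRel (A B : Type*) [Ring A] [Ring B] (ρ ρ' : A →+* B) : Prop :=
  ∃ u : Bˣ, ∀ a : A, ρ' a = ↑u * ρ a * ↑u⁻¹

/-- The conductor of a subring `Γ` of `L`: the ideal `{x ∈ O_L : x·O_L ⊆ Γ}` of the
ring of integers `O_L` of `L`. -/
def orderConductor (L : Type*) [Field L] (Γ : Subring L) : Ideal (𝓞 L) where
  carrier := {x : 𝓞 L | ∀ y : 𝓞 L, algebraMap (𝓞 L) L (x * y) ∈ Γ}
  add_mem' := by
    intro a b ha hb y
    have : (a + b) * y = a * y + b * y := add_mul a b y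
    rw [this, map_add]
    exact Γ.add_mem (ha y) (hb y)
  zero_mem' := by
    intro y
    rw [zero_mul, map_zero]
    exact Γ.zero_mem
  smul_mem' := by
    intro c x hx y
    have : c • x * y = x * (c * y) := by rw [smul_eq_mul]; ring
    rw [this]
    exact hx (c * y)


section abstractOrders

open scoped nonZeroDivisors

/-- Every ideal class of a Dedekind domain contains an ideal coprime to a given ideal. -/
theorem gs_exists_coprime_rep {B : Type*} [CommRing B] [IsDedekindDomain B] (f : Ideal B)
    (hf : f ≠ ⊥) (C : ClassGroup B) :
    ∃ J : (Ideal B)⁰, ClassGroup.mk0 J = C ∧ (J : Ideal B) ⊔ f = ⊤ := by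
  obtain ⟨I, hI⟩ := ClassGroup.mk0_surjective C⁻¹
  have hI0 : (I : Ideal B) ≠ 0 := nonZeroDivisors.coe_ne_zero I
  have hle : f * (I : Ideal B) ≤ I := Ideal.mul_le_right
  have hne : f * (I : Ideal B) ≠ 0 := mul_ne_zero hf hI0
  obtain ⟨a, ha⟩ := IsDedekindDomain.exists_sup_span_eq hle hne
  by_cases ha0 : a = 0
  · subst ha0
    have h1 : f * (I : Ideal B) = 1 * I := by simpa using ha
    have h2 : f = 1 := mul_right_cancel₀ hI0 h1
    obtain ⟨J, hJ⟩ := ClassGroup.mk0_surjective C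
    exact ⟨J, hJ, by rw [h2, Ideal.one_eq_top, sup_top_eq]⟩
  have haI : Ideal.span {a} ≤ (I : Ideal B) := ha ▸ le_sup_right
  obtain ⟨J, hJ⟩ := Ideal.dvd_iff_le.mpr haI
  have hJ0 : J ≠ 0 := by
    rintro rfl
    apply ha0
    simpa using hJ
  refine ⟨⟨J, mem_nonZeroDivisors_of_ne_zero hJ0⟩, ?_, ?_⟩
  · have : ClassGroup.mk0 ⟨J, mem_nonZeroDivisors_of_ne_zero hJ0⟩ = (ClassGroup.mk0 I)⁻¹ := by
      rw [ClassGroup.mk0_eq_mk0_inv_iff]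
      exact ⟨a, ha0, by rw [hJ, mul_comm]⟩
    rw [this, hI, inv_inv]
  · have h1 : (I : Ideal B) * (J ⊔ f) = I * 1 := by
      rw [Ideal.mul_sup, ← hJ, mul_one, mul_comm _ f, sup_comm, ha]
    have h2 : J ⊔ f = 1 := mul_left_cancel₀ hI0 h1
    rw [Ideal.one_eq_top] at h2
    exact h2

variable {A B : Type*} [CommRing A] [IsDomain A] [CommRing B] [IsDedekindDomain B]

theorem gs_exists_split {f J : Ideal B} (h : J ⊔ f = ⊤) :
    ∃ a ∈ J, ∃ b ∈ f, a + b = 1 := by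
  have : (1 : B) ∈ J ⊔ f := h ▸ Submodule.mem_top
  exact Submodule.mem_sup.mp this

theorem gs_map_comap (ι : A →+* B) (f J : Ideal B) (hfι : ∀ e ∈ f, ∃ x, ι x = e)
    (h : J ⊔ f = ⊤) : (J.comap ι).map ι = J := by
  apply le_antisymm Ideal.map_comap_le
  intro j hj
  obtain ⟨a, ha, b, hb, hab⟩ := gs_exists_split h
  have hj' : j = j * a + j * b := by rw [← mul_add, hab, mul_one]
  rw [hj']
  apply Ideal.add_mem
  · apply Ideal.mul_mem_left
    obtain ⟨β, hβ⟩ := hfι b hb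
    have : ι (1 - β) = a := by rw [map_sub, map_one, hβ, ← hab]; ring
    rw [← this]
    apply Ideal.mem_map_of_mem
    rw [Ideal.mem_comap, this]
    exact ha
  · obtain ⟨x, hx⟩ := hfι (j * b) (f.mul_mem_left _ hb)
    rw [← hx]
    apply Ideal.mem_map_of_mem
    rw [Ideal.mem_comap, hx]
    exact J.mul_mem_right _ hj

theorem gs_comap_mul (ι : A →+* B) (hι : Function.Injective ι) (f J : Ideal B)
    (hfι : ∀ e ∈ f, ∃ x, ι x = e) (hJ0 : J ≠ ⊥) (h : J ⊔ f = ⊤) :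
    ∃ (J₂ : Ideal A) (d : A), d ≠ 0 ∧ J.comap ι * J₂ = Ideal.span {d} := by
  obtain ⟨a, ha, b, hb, hab⟩ := gs_exists_split h
  by_cases ha0 : a = 0
  · -- then f is everything and ι is surjective
    have hb1 : b = 1 := by rw [← hab, ha0, zero_add]
    have hsurj : ∀ y, ∃ x, ι x = y := fun y => hfι y (by
      have := f.mul_mem_left y hb; rwa [hb1, mul_one] at this)
    obtain ⟨c, hc, hc0⟩ := Submodule.exists_mem_ne_zero_of_ne_bot hJ0
    obtain ⟨J₂, hJ₂⟩ := Ideal.dvd_iff_le.mpr ((Ideal.span_singleton_le_iff_mem J).mpr hc)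
    obtain ⟨γ, hγ⟩ := hsurj c
    let e : A ≃+* B := RingEquiv.ofBijective ι ⟨hι, hsurj⟩
    refine ⟨J₂.comap ι, γ, ?_, ?_⟩
    · rintro rfl
      exact hc0 (by rw [← hγ, map_zero])
    · have h1 : (Ideal.map ι (J.comap ι * J₂.comap ι)) = Ideal.map ι (Ideal.span {γ}) := by
        rw [Ideal.map_mul, Ideal.map_comap_of_surjective ι hsurj,
          Ideal.map_comap_of_surjective ι hsurj, ← hJ₂, Ideal.map_span, Set.image_singleton, hγ]
      have h2 := congrArg (Ideal.comap ι) h1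
      rwa [Ideal.comap_map_of_bijective ι ⟨hι, hsurj⟩,
        Ideal.comap_map_of_bijective ι ⟨hι, hsurj⟩] at h2
  obtain ⟨J₂, hJ₂⟩ := Ideal.dvd_iff_le.mpr ((Ideal.span_singleton_le_iff_mem J).mpr ha)
  have haJ₂ : a ∈ J₂ := by
    have : Ideal.span {a} ≤ J₂ := hJ₂ ▸ Ideal.mul_le_right
    exact this (Ideal.mem_span_singleton_self a)
  obtain ⟨β, hβ⟩ := hfι b hb
  have hα : ι (1 - β) = a := by rw [map_sub, map_one, hβ, ← hab]; ring
  refine ⟨J₂.comap ι, 1 - β, ?_, ?_⟩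
  · intro h0
    rw [h0, map_zero] at hα
    exact ha0 hα.symm
  apply le_antisymm
  · rw [Ideal.mul_le]
    intro x hx y hy
    have h1 : ι x * ι y ∈ Ideal.span {a} := hJ₂ ▸ Ideal.mul_mem_mul hx hy
    obtain ⟨t, ht⟩ := Ideal.mem_span_singleton'.mp h1
    obtain ⟨s, hs⟩ := hfι (t * b) (f.mul_mem_left _ hb)
    have ht' : ι (x * y + s) = t := by
      rw [map_add, map_mul, hs, ← ht, ← mul_add, hab, mul_one]
    rw [Ideal.mem_span_singleton']
    refine ⟨x * y + s, hι ?_⟩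
    rw [map_mul, ht', hα, ht, map_mul]
  · rw [Ideal.span_singleton_le_iff_mem]
    have key : ∀ t ∈ J * J₂, ∃ τ ∈ J.comap ι * J₂.comap ι, ι τ = t * b * b := by
      intro t ht
      induction ht using Submodule.mul_induction_on' with
      | mem_mul_mem x hx y hy =>
        obtain ⟨x', hx'⟩ := hfι (x * b) (f.mul_mem_left _ hb)
        obtain ⟨y', hy'⟩ := hfι (y * b) (f.mul_mem_left _ hb)
        refine ⟨x' * y', Ideal.mul_mem_mul ?_ ?_, ?_⟩
        · rw [Ideal.mem_comap, hx']; exact J.mul_mem_right _ hx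
        · rw [Ideal.mem_comap, hy']; exact J₂.mul_mem_right _ hy
        · rw [map_mul, hx', hy']; ring
      | add x _ y _ h1 h2 =>
        obtain ⟨u, hu, hu'⟩ := h1
        obtain ⟨v, hv, hv'⟩ := h2
        exact ⟨u + v, Ideal.add_mem _ hu hv, by rw [map_add, hu', hv']; ring⟩
    obtain ⟨τ, hτ, hτ'⟩ := key a (hJ₂ ▸ Ideal.mem_span_singleton_self a)
    have hsq : (1 - β) * (1 - β) ∈ J.comap ι * J₂.comap ι := by
      apply Ideal.mul_mem_mul
      · rw [Ideal.mem_comap, hα]; exact ha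
      · rw [Ideal.mem_comap, hα]; exact haJ₂
    have : 1 - β = (1 + β) * ((1 - β) * (1 - β)) + τ := by
      apply hι
      rw [map_add, map_mul, map_mul, hτ', hα, map_add, map_one, hβ]
      have : a = 1 - b := by rw [← hab]; ring
      rw [this]; ring
    rw [this]
    exact Ideal.add_mem _ (Ideal.mul_mem_left _ _ hsq) hτ

theorem gs_isUnit_of_mul (I J : Ideal A) (d : A) (hd : d ≠ 0) (h : I * J = Ideal.span {d}) :
    IsUnit (I : FractionalIdeal A⁰ (FractionRing A)) := by
  have hd' : algebraMap A (FractionRing A) d ≠ 0 := by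
    simpa using hd
  have h1 : (I : FractionalIdeal A⁰ (FractionRing A)) * J =
      FractionalIdeal.spanSingleton A⁰ (algebraMap A (FractionRing A) d) := by
    rw [← FractionalIdeal.coeIdeal_mul, h, FractionalIdeal.coeIdeal_span_singleton]
  apply IsUnit.of_mul_eq_one
    (J * FractionalIdeal.spanSingleton A⁰ (algebraMap A (FractionRing A) d)⁻¹)
  rw [← mul_assoc, h1, FractionalIdeal.spanSingleton_mul_spanSingleton, mul_inv_cancel₀ hd',
    FractionalIdeal.spanSingleton_one]

/-- Class number of the maximal order injects in the class group of the order. -/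
theorem gs_exists_injection (ι : A →+* B) (hι : Function.Injective ι) (f : Ideal B) (hf : f ≠ ⊥)
    (hfι : ∀ e ∈ f, ∃ x, ι x = e) :
    ∃ F : ClassGroup B → ClassGroup A, Function.Injective F := by
  choose J hJ hJf using gs_exists_coprime_rep f hf
  have hU : ∀ C, IsUnit (((J C : Ideal B).comap ι : Ideal A) :
      FractionalIdeal A⁰ (FractionRing A)) := by
    intro C
    obtain ⟨J₂, d, hd, h⟩ := gs_comap_mul ι hι f (J C) hfι (nonZeroDivisors.coe_ne_zero (J C))
      (hJf C)
    exact gs_isUnit_of_mul _ _ d hd h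
  refine ⟨fun C => ClassGroup.mk (FractionRing A) (hU C).unit, ?_⟩
  intro C D hCD
  obtain ⟨x, y, hx, hy, hxy⟩ := (ClassGroup.mk_eq_mk_of_coe_ideal
    (IsUnit.unit_spec (hU C)) (IsUnit.unit_spec (hU D))).mp hCD
  rw [← hJ C, ← hJ D, ClassGroup.mk0_eq_mk0_iff]
  refine ⟨ι x, ι y, ?_, ?_, ?_⟩
  · rwa [Ne, map_eq_zero_iff ι hι]
  · rwa [Ne, map_eq_zero_iff ι hι]
  · have := congrArg (Ideal.map ι) hxy
    simpa only [Ideal.map_mul, gs_map_comap ι f _ hfι (hJf _), Ideal.map_span,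
      Set.image_singleton] using this

/-- Every class has an integral representative. -/
theorem gs_exists_integral (C : ClassGroup A) : ∃ (I : Ideal A)
    (u : (FractionalIdeal A⁰ (FractionRing A))ˣ), I ≠ ⊥ ∧
    (u : FractionalIdeal A⁰ (FractionRing A)) = I ∧ IsUnit (I : FractionalIdeal A⁰ (FractionRing A)) ∧
    ClassGroup.mk (FractionRing A) u = C := by
  refine ClassGroup.induction (K := FractionRing A) (fun I => ?_) C
  have hu : IsUnit ((I : FractionalIdeal A⁰ (FractionRing A)).num :
    FractionalIdeal A⁰ (FractionRing A)) := FractionalIdeal.isUnit_num.mpr I.isUnit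
  refine ⟨(I : FractionalIdeal A⁰ (FractionRing A)).num, hu.unit, ?_, hu.unit_spec, hu, ?_⟩
  · have := nonZeroDivisors.ne_zero (ClassGroup.integralRep_mem_nonZeroDivisors I.ne_zero)
    exact this
  · rw [eq_comm, ClassGroup.mk_eq_mk]
    have fd_ne_zero : (algebraMap A (FractionRing A)) I.1.den ≠ 0 :=
      IsFractionRing.to_map_ne_zero_of_mem_nonZeroDivisors (SetLike.coe_mem _)
    refine ⟨Units.mk0 (algebraMap A _ I.1.den) fd_ne_zero, ?_⟩
    apply Units.ext
    rw [mul_comm, Units.val_mul, coe_toPrincipalIdeal, Units.val_mk0]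
    exact FractionalIdeal.den_mul_self_eq_num' A⁰ (FractionRing A) I

end abstractOrders

section lattices

open scoped nonZeroDivisors

variable {L : Type*} [Field L] [NumberField L] (Γ : Subring L)

theorem gs_exists_nat_mul_mem (hΓspan : Submodule.span ℚ (Γ : Set L) = ⊤) (x : L) :
    ∃ k : ℤ, k ≠ 0 ∧ (k : L) * x ∈ Γ := by
  have hx : x ∈ Submodule.span ℚ (Γ : Set L) := hΓspan ▸ Submodule.mem_top
  induction hx using Submodule.span_induction with
  | mem x hx => exact ⟨1, one_ne_zero, by simpa using hx⟩
  | zero => exact ⟨1, one_ne_zero, by simp⟩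
  | add x y _ _ h1 h2 =>
    obtain ⟨k, hk, hkx⟩ := h1
    obtain ⟨l, hl, hly⟩ := h2
    refine ⟨k * l, mul_ne_zero hk hl, ?_⟩
    have : ((k * l : ℤ) : L) * (x + y) = (l : L) * (k * x) + (k : L) * (l * y) := by
      push_cast; ring
    rw [this]
    exact Γ.add_mem (Γ.mul_mem (intCast_mem Γ l) hkx) (Γ.mul_mem (intCast_mem Γ k) hly)
  | smul q x _ h1 =>
    obtain ⟨k, hk, hkx⟩ := h1
    refine ⟨k * q.den, mul_ne_zero hk (by exact_mod_cast q.den_ne_zero), ?_⟩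
    have hq : (q.den : L) * (q : L) = (q.num : L) := by
      have := Rat.den_mul_eq_num q
      exact_mod_cast congrArg (fun r : ℚ => (r : L)) this
    have : ((k * q.den : ℤ) : L) * (q • x) = (q.num : L) * (k * x) := by
      rw [Rat.smul_def, ← hq]; push_cast; ring
    rw [this]
    exact Γ.mul_mem (intCast_mem Γ _) hkx

theorem gs_conductor_ne_bot (hΓspan : Submodule.span ℚ (Γ : Set L) = ⊤) :
    orderConductor L Γ ≠ ⊥ := by
  choose k hk hkx using gs_exists_nat_mul_mem Γ hΓspan
  let b := RingOfIntegers.basis L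
  let N : ℤ := ∏ i, k (algebraMap (𝓞 L) L (b i))
  have hN : N ≠ 0 := Finset.prod_ne_zero_iff.mpr fun i _ => hk _
  have hmem : (N : 𝓞 L) ∈ orderConductor L Γ := by
    intro y
    have hy : y ∈ Submodule.span ℤ (Set.range b) := b.span_eq ▸ Submodule.mem_top
    induction hy using Submodule.span_induction with
    | mem x hx =>
      obtain ⟨i, rfl⟩ := hx
      obtain ⟨m, hm⟩ : k (algebraMap (𝓞 L) L (b i)) ∣ N :=
        Finset.dvd_prod_of_mem _ (Finset.mem_univ i)
      have : algebraMap (𝓞 L) L (N * b i) =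
          (m : L) * (k (algebraMap (𝓞 L) L (b i)) * algebraMap (𝓞 L) L (b i)) := by
        rw [map_mul, map_intCast]
        conv_lhs => rw [hm]
        push_cast; ring
      rw [this]
      exact Γ.mul_mem (intCast_mem Γ _) (hkx _)
    | zero => simp
    | add x y _ _ h1 h2 => rw [mul_add, map_add]; exact Γ.add_mem h1 h2
    | smul c x _ h1 =>
      rw [mul_smul_comm, map_zsmul]
      exact Γ.zsmul_mem h1 c
  intro h
  rw [h] at hmem
  exact hN (by exact_mod_cast (Ideal.mem_bot.mp hmem))

theorem gs_exists_embed (hΓfin : Module.Finite ℤ Γ) :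
    ∃ ι : Γ →+* 𝓞 L, ∀ γ, algebraMap (𝓞 L) L (ι γ) = γ := by
  have h : ∀ γ : Γ, (γ : L) ∈ integralClosure ℤ L := by
    intro γ
    have := (Algebra.IsIntegral.of_finite ℤ Γ).isIntegral γ
    exact this.map (Γ.subtype.toIntAlgHom)
  exact ⟨(Γ.subtype).codRestrict (integralClosure ℤ L) h, fun γ => rfl⟩

/-- A finitely generated subgroup of `L` is generated by `g` elements. -/
theorem gs_exists_gens (M : Submodule ℤ L) (hM : M.FG) :
    ∃ v : Fin (Module.finrank ℚ L) → L, Submodule.span ℤ (Set.range v) = M := by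
  have : Module.Finite ℤ M := Module.Finite.iff_fg.mpr hM
  let b := Module.finBasis ℤ M
  have hli : LinearIndependent ℤ (fun i => (b i : L)) :=
    b.linearIndependent.map' M.subtype (Submodule.ker_subtype M)
  rw [LinearIndependent.iff_fractionRing ℤ ℚ] at hli
  have hcard := hli.fintype_card_le_finrank
  rw [Fintype.card_fin] at hcard
  have hspan : Submodule.span ℤ (Set.range fun i => (b i : L)) = M := by
    have h1 := congrArg (Submodule.map M.subtype) b.span_eq
    rw [Submodule.map_span, ← Set.range_comp, Submodule.map_top, Submodule.range_subtype] at h1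
    exact h1
  refine ⟨fun i => if h : (i : ℕ) < Module.finrank ℤ M then (b ⟨i, h⟩ : L) else 0, ?_⟩
  apply le_antisymm
  · rw [Submodule.span_le]
    rintro _ ⟨i, rfl⟩
    dsimp only
    split_ifs with h
    · exact (b _).2
    · exact M.zero_mem
  · refine hspan.symm.le.trans ?_
    rw [Submodule.span_le]
    rintro _ ⟨i, rfl⟩
    apply Submodule.subset_span
    refine ⟨⟨i, lt_of_lt_of_le i.2 hcard⟩, ?_⟩
    simp

/-- `z` is a normalised set of generators of a homothetic copy of the lattice `M`. -/
def GsNormal (M : Submodule ℤ L) (J : Ideal (𝓞 L)) {g : ℕ} (z : Fin g → 𝓞 L) : Prop :=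
  Ideal.span (Set.range z) = J ∧ ∃ c : L, c ≠ 0 ∧
    ∀ m, c * m ∈ M ↔ m ∈ Submodule.span ℤ (Set.range fun i => algebraMap (𝓞 L) L (z i))

theorem gs_exists_normal (M : Submodule ℤ L) (hM : M.FG) (hM0 : M ≠ ⊥)
    (J : ClassGroup (𝓞 L) → (Ideal (𝓞 L))⁰) (hJ : ∀ C, ClassGroup.mk0 (J C) = C) :
    ∃ (C : ClassGroup (𝓞 L)) (z : Fin (Module.finrank ℚ L) → 𝓞 L), GsNormal M (J C) z := by
  obtain ⟨v, hv⟩ := gs_exists_gens M hM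
  obtain ⟨⟨d, hd⟩, hdv⟩ := IsLocalization.exist_integer_multiples_of_finite (𝓞 L)⁰ v
  choose w hw using hdv
  have hd0 : algebraMap (𝓞 L) L d ≠ 0 :=
    IsFractionRing.to_map_ne_zero_of_mem_nonZeroDivisors hd
  replace hw : ∀ i, algebraMap (𝓞 L) L (w i) = algebraMap (𝓞 L) L d * v i := by
    intro i
    rw [hw i, Algebra.smul_def]
  have hA0 : Ideal.span (Set.range w) ≠ ⊥ := by
    intro h
    rw [Ideal.span_eq_bot] at h
    apply hM0
    rw [← hv, Submodule.span_eq_bot]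
    rintro _ ⟨i, rfl⟩
    have h1 := hw i
    rw [h _ ⟨i, rfl⟩, map_zero] at h1
    exact (mul_eq_zero.mp h1.symm).resolve_left hd0
  let A : (Ideal (𝓞 L))⁰ := ⟨Ideal.span (Set.range w), mem_nonZeroDivisors_of_ne_zero hA0⟩
  obtain ⟨x, y, hx, hy, hxy⟩ := ClassGroup.mk0_eq_mk0_iff.mp (hJ (ClassGroup.mk0 A)).symm
  have hz : ∀ i, ∃ z ∈ (J (ClassGroup.mk0 A) : Ideal (𝓞 L)), y * z = x * w i := by
    intro i
    have : x * w i ∈ Ideal.span {x} * (A : Ideal (𝓞 L)) :=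
      Ideal.mul_mem_mul (Ideal.mem_span_singleton_self x) (Ideal.subset_span ⟨i, rfl⟩)
    rw [hxy] at this
    exact Ideal.mem_span_singleton_mul.mp this
  choose z hzJ hz using hz
  refine ⟨ClassGroup.mk0 A, z, ?_, ?_⟩
  · have hy' : Ideal.span {y} ≠ (0 : Ideal (𝓞 L)) := by
      rwa [Ne, Ideal.zero_eq_bot, Ideal.span_singleton_eq_bot]
    apply mul_left_cancel₀ hy'
    rw [← hxy]
    show _ = Ideal.span {x} * Ideal.span (Set.range w)
    rw [Ideal.span_mul_span', Ideal.span_mul_span', Set.singleton_mul, Set.singleton_mul,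
      ← Set.range_comp, ← Set.range_comp]
    congr 2
    funext i
    exact hz i
  · have hx' : algebraMap (𝓞 L) L x ≠ 0 := by simpa using hx
    have hy' : algebraMap (𝓞 L) L y ≠ 0 := by simpa using hy
    set c : L := algebraMap (𝓞 L) L y / (algebraMap (𝓞 L) L x * algebraMap (𝓞 L) L d) with hc
    have hc0 : c ≠ 0 := div_ne_zero hy' (mul_ne_zero hx' hd0)
    refine ⟨c, hc0, ?_⟩
    have hcz : ∀ i, c * algebraMap (𝓞 L) L (z i) = v i := by
      intro i
      have h1 := congrArg (algebraMap (𝓞 L) L) (hz i)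
      rw [map_mul, map_mul, hw] at h1
      rw [hc, div_mul_eq_mul_div, h1]
      field_simp
    have hmap : M = Submodule.map (LinearMap.mulLeft ℤ c)
        (Submodule.span ℤ (Set.range fun i => algebraMap (𝓞 L) L (z i))) := by
      rw [Submodule.map_span, ← Set.range_comp, ← hv]
      congr 2
      funext i
      exact (hcz i).symm
    intro m
    rw [hmap]
    constructor
    · rintro ⟨m', hm', h⟩
      have : m' = m := mul_left_cancel₀ hc0 h
      exact this ▸ hm'
    · intro hm
      exact ⟨m, hm, rfl⟩

theorem gs_normal_le (M : Submodule ℤ L) (hMΓ : ∀ γ ∈ Γ, ∀ m ∈ M, γ * m ∈ M)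
    (J : Ideal (𝓞 L)) {g : ℕ} {z z' : Fin g → 𝓞 L} (hz : GsNormal M J z)
    (hJf : J ⊔ orderConductor L Γ = ⊤) (hz'J : ∀ i, z' i ∈ J)
    (h : ∀ i, z' i - z i ∈ orderConductor L Γ) :
    Submodule.span ℤ (Set.range fun i => algebraMap (𝓞 L) L (z' i)) ≤
      Submodule.span ℤ (Set.range fun i => algebraMap (𝓞 L) L (z i)) := by
  obtain ⟨hzJ, c, hc0, hc⟩ := hz
  set S := Submodule.span ℤ (Set.range fun i => algebraMap (𝓞 L) L (z i)) with hS
  have hSΓ : ∀ γ ∈ Γ, ∀ m ∈ S, γ * m ∈ S := by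
    intro γ hγ m hm
    rw [← hc] at hm ⊢
    have := hMΓ γ hγ _ hm
    rwa [mul_left_comm] at this
  have hfJ : ∀ e ∈ orderConductor L Γ, ∀ j ∈ J, algebraMap (𝓞 L) L (e * j) ∈ S := by
    intro e he j hj
    rw [← hzJ] at hj
    induction hj using Submodule.span_induction generalizing e with
    | mem x hx =>
      obtain ⟨i, rfl⟩ := hx
      rw [map_mul]
      apply hSΓ
      · simpa using he 1
      · exact Submodule.subset_span ⟨i, rfl⟩
    | zero => simp
    | add x y _ _ h1 h2 => rw [mul_add, map_add]; exact S.add_mem (h1 e he) (h2 e he)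
    | smul a x _ h1 =>
      have := h1 (e * a) (Ideal.mul_mem_right _ _ he)
      rwa [mul_assoc] at this
  rw [Submodule.span_le]
  rintro _ ⟨i, rfl⟩
  have hziJ : z i ∈ J := hzJ ▸ Ideal.subset_span ⟨i, rfl⟩
  have hd : algebraMap (𝓞 L) L (z' i - z i) ∈ S := by
    obtain ⟨a, ha, b, hb, hab⟩ := gs_exists_split hJf
    have h1 : z' i - z i = (z' i - z i) * a + b * (z' i - z i) := by
      rw [mul_comm b, ← mul_add, hab, mul_one]
    rw [h1, map_add]
    exact S.add_mem (hfJ _ (h i) _ ha) (hfJ _ hb _ (J.sub_mem (hz'J i) hziJ))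
  have h2 : algebraMap (𝓞 L) L (z i) ∈ S := Submodule.subset_span ⟨i, rfl⟩
  have := S.add_mem hd h2
  rwa [← map_add, sub_add_cancel] at this

/-- Lattices stable under `Γ`. -/
def GsLattice (M : Submodule ℤ L) : Prop :=
  M.FG ∧ M ≠ ⊥ ∧ ∀ γ ∈ Γ, ∀ m ∈ M, γ * m ∈ M

theorem gs_classify (hΓspan : Submodule.span ℚ (Γ : Set L) = ⊤) :
    ∃ Φ : {M : Submodule ℤ L // GsLattice Γ M} →
      ClassGroup (𝓞 L) × (Fin (Module.finrank ℚ L) → 𝓞 L ⧸ orderConductor L Γ),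
      ∀ M M', Φ M = Φ M' → ∃ c : L, c ≠ 0 ∧ ∀ m, m ∈ M.1 ↔ c * m ∈ M'.1 := by
  choose J hJ hJf using gs_exists_coprime_rep (orderConductor L Γ) (gs_conductor_ne_bot Γ hΓspan)
  have := fun M : {M : Submodule ℤ L // GsLattice Γ M} =>
    gs_exists_normal M.1 M.2.1 M.2.2.1 J hJ
  choose C z hz using this
  refine ⟨fun M => (C M, fun i => Ideal.Quotient.mk _ (z M i)), ?_⟩
  intro M M' h
  rw [Prod.mk.injEq] at h
  obtain ⟨h1, h2⟩ := h
  have h3 : ∀ i, z M i - z M' i ∈ orderConductor L Γ := fun i =>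
    Ideal.Quotient.eq.mp (congrFun h2 i)
  have h3' : ∀ i, z M' i - z M i ∈ orderConductor L Γ := fun i =>
    Ideal.Quotient.eq.mp (congrFun h2 i).symm
  have hzM := hz M
  have hzM' := hz M'
  rw [← h1] at hzM'
  have hle := gs_normal_le Γ M.1 M.2.2.2 _ hzM (hJf _)
    (fun i => hzM'.1 ▸ Ideal.subset_span ⟨i, rfl⟩) h3'
  have hle' := gs_normal_le Γ M'.1 M'.2.2.2 _ hzM' (hJf _)
    (fun i => hzM.1 ▸ Ideal.subset_span ⟨i, rfl⟩) h3
  have heq := le_antisymm hle hle'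
  obtain ⟨-, c, hc0, hc⟩ := hzM
  obtain ⟨-, c', hc0', hc'⟩ := hzM'
  refine ⟨c' / c, div_ne_zero hc0' hc0, fun m => ?_⟩
  have e1 : m = c * (m / c) := by field_simp
  have e2 : c' / c * m = c' * (m / c) := by field_simp
  rw [e2, hc', heq]
  conv_lhs => rw [e1]
  rw [hc]

theorem gs_finite_quot (hΓspan : Submodule.span ℚ (Γ : Set L) = ⊤) :
    Finite (𝓞 L ⧸ orderConductor L Γ) :=
  Ideal.finiteQuotientOfFreeOfNeBot _ (gs_conductor_ne_bot Γ hΓspan)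

theorem gs_finite_classGroup (hΓfin : Module.Finite ℤ Γ)
    (hΓspan : Submodule.span ℚ (Γ : Set L) = ⊤) : Finite (ClassGroup Γ) := by
  obtain ⟨Φ, hΦ⟩ := gs_classify Γ hΓspan
  have := gs_finite_quot Γ hΓspan
  choose I u hI0 huI hU huC using gs_exists_integral (A := Γ)
  let j : Γ →ₗ[ℤ] L := Γ.subtype.toAddMonoidHom.toIntLinearMap
  have hj : ∀ γ : Γ, j γ = γ := fun _ => rfl
  let N : Ideal Γ → Submodule ℤ L := fun I => (I.restrictScalars ℤ).map j
  have hmemN : ∀ (I : Ideal Γ) (γ : Γ), (γ : L) ∈ N I ↔ γ ∈ I := by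
    intro I γ
    constructor
    · rintro ⟨γ', h1, h2⟩
      rw [hj] at h2
      have : γ' = γ := Subtype.ext h2
      exact this ▸ h1
    · intro h
      exact ⟨γ, h, rfl⟩
  have hN : ∀ C, GsLattice Γ (N (I C)) := by
    intro C
    refine ⟨?_, ?_, ?_⟩
    · exact Submodule.FG.map _ (IsNoetherian.noetherian _)
    · obtain ⟨x, hx, hx0⟩ := Submodule.exists_mem_ne_zero_of_ne_bot (hI0 C)
      intro h
      have h1 := (hmemN (I C) x).mpr hx
      rw [h, Submodule.mem_bot] at h1
      exact hx0 (Subtype.ext h1)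
    · rintro γ hγ _ ⟨x, hx, rfl⟩
      exact ⟨⟨γ, hγ⟩ * x, Ideal.mul_mem_left _ _ hx, rfl⟩
  apply Finite.of_injective (fun C => Φ ⟨N (I C), hN C⟩)
  intro C D hCD
  obtain ⟨c, hc0, hc⟩ := hΦ _ _ hCD
  dsimp only at hc
  rw [← huC C, ← huC D, ClassGroup.mk_eq_mk_of_coe_ideal (huI C) (huI D)]
  obtain ⟨x, hx, hx0⟩ := Submodule.exists_mem_ne_zero_of_ne_bot (hI0 C)
  obtain ⟨y, hy, hyx⟩ := (hc x).mp ((hmemN _ _).mpr hx)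
  rw [hj] at hyx
  have hx0' : (x : L) ≠ 0 := fun h => hx0 (Subtype.ext h)
  have hy0 : y ≠ 0 := by
    rintro rfl
    exact mul_ne_zero hc0 hx0' hyx.symm
  refine ⟨y, x, hy0, hx0, ?_⟩
  apply le_antisymm
  · rw [Ideal.span_singleton_mul_le_iff]
    intro s hs
    rw [Ideal.mem_span_singleton_mul]
    obtain ⟨t, ht, hts⟩ := (hc s).mp ((hmemN _ _).mpr hs)
    refine ⟨t, ht, Subtype.ext ?_⟩
    rw [hj] at hts
    push_cast
    rw [hts, hyx]; ring
  · rw [Ideal.span_singleton_mul_le_iff]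
    intro t ht
    rw [Ideal.mem_span_singleton_mul]
    have e : c * (c⁻¹ * t) = t := by field_simp
    obtain ⟨s, hs, hst⟩ := (hc (c⁻¹ * t)).mpr (by rw [e]; exact (hmemN _ _).mpr ht)
    refine ⟨s, hs, Subtype.ext ?_⟩
    rw [hj] at hst
    push_cast
    rw [hst, hyx]; field_simp

end lattices

section matrices

open Matrix

variable {L : Type*} [Field L] [NumberField L] (Γ : Subring L)

/-- A ring homomorphism on an order extends to the field. -/
theorem gs_extend (hΓspan : Submodule.span ℚ (Γ : Set L) = ⊤) {A : Type*} [Ring A] [Algebra ℚ A]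
    (ρ : Γ →+* A) : ∃ ρL : L →+* A, ∀ γ : Γ, ρL γ = ρ γ := by
  choose k hk hkx using gs_exists_nat_mul_mem Γ hΓspan
  let r : L → A := fun x => (k x : ℚ)⁻¹ • ρ ⟨_, hkx x⟩
  have key : ∀ (x : L) (l : ℤ) (γ : Γ), l ≠ 0 → (l : L) * x = γ → r x = (l : ℚ)⁻¹ • ρ γ := by
    intro x l γ hl h
    have hk' : (k x : ℚ) ≠ 0 := by exact_mod_cast hk x
    have hl' : (l : ℚ) ≠ 0 := by exact_mod_cast hl
    have h1 : (l : Γ) * ⟨_, hkx x⟩ = (k x : Γ) * γ := by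
      apply Subtype.ext
      push_cast
      rw [← h]; ring
    have h2 := congrArg ρ h1
    rw [map_mul, map_mul, map_intCast, map_intCast] at h2
    have e : ∀ (m : ℤ) (a : A), (m : A) * a = (m : ℚ) • a := by
      intro m a
      rw [Algebra.smul_def, map_intCast]
    rw [e, e] at h2
    show (k x : ℚ)⁻¹ • ρ ⟨_, hkx x⟩ = _
    rw [inv_smul_eq_iff₀ hk', smul_comm, ← h2, inv_smul_smul₀ hl']
  have hΓ : ∀ γ : Γ, r γ = ρ γ := by
    intro γ
    rw [key γ 1 γ one_ne_zero (by simp)]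
    simp
  refine ⟨{ toFun := r, map_one' := ?_, map_zero' := ?_, map_mul' := ?_, map_add' := ?_ }, hΓ⟩
  · simpa using hΓ 1
  · intro x y
    rw [key (x * y) (k x * k y) (⟨_, hkx x⟩ * ⟨_, hkx y⟩) (mul_ne_zero (hk x) (hk y))
      (by push_cast; ring)]
    show _ = ((k x : ℚ)⁻¹ • ρ ⟨_, hkx x⟩) * ((k y : ℚ)⁻¹ • ρ ⟨_, hkx y⟩)
    rw [smul_mul_smul_comm, map_mul]
    push_cast
    rw [mul_inv]
  · simpa using hΓ 0
  · intro x y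
    have hx : (k x : ℚ) ≠ 0 := by exact_mod_cast hk x
    have hy : (k y : ℚ) ≠ 0 := by exact_mod_cast hk y
    rw [key (x + y) (k x * k y) ((k y : Γ) * ⟨_, hkx x⟩ + (k x : Γ) * ⟨_, hkx y⟩)
      (mul_ne_zero (hk x) (hk y)) (by push_cast; ring)]
    show _ = ((k x : ℚ)⁻¹ • ρ ⟨_, hkx x⟩) + ((k y : ℚ)⁻¹ • ρ ⟨_, hkx y⟩)
    have e : ∀ (m : ℤ) (a : A), (m : A) * a = (m : ℚ) • a := by
      intro m a
      rw [Algebra.smul_def, map_intCast]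
    rw [map_add, map_mul, map_mul, map_intCast, map_intCast, e, e, smul_add, smul_smul, smul_smul]
    congr 2
    · push_cast; field_simp
    · push_cast; field_simp

variable {K : Type*} [Field K] [NumberField K]

theorem gs_data [Algebra K L] (hΓspan : Submodule.span ℚ (Γ : Set L) = ⊤)
    (n : ℕ) (hn : n = Module.finrank K L) (ρ : Γ →+* Matrix (Fin n) (Fin n) (𝓞 K)) :
    ∃ (σ : K →+* L) (φ : L ≃+ (Fin n → K)),
      (∀ (γ : Γ) y, φ (γ * y) = ((ρ γ).map (algebraMap (𝓞 K) K)) *ᵥ φ y) ∧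
      (∀ k y, φ (σ k * y) = k • φ y) := by
  have : Module.Finite K L := Module.Finite.of_restrictScalars_finite ℚ K L
  have hn0 : 0 < n := hn ▸ Module.finrank_pos
  obtain ⟨ρL, hρL⟩ := gs_extend Γ hΓspan ((algebraMap (𝓞 K) K).mapMatrix.comp ρ)
  let v0 : Fin n → K := Pi.single ⟨0, hn0⟩ 1
  have hv0 : v0 ≠ 0 := by
    intro h
    have := congrFun h ⟨0, hn0⟩
    simp [v0] at this
  let φ0 : L →+ (Fin n → K) :=
    { toFun := fun x => ρL x *ᵥ v0
      map_zero' := by simp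
      map_add' := fun x y => by rw [map_add, Matrix.add_mulVec] }
  have hφ0mul : ∀ x y, φ0 (x * y) = ρL x *ᵥ φ0 y := by
    intro x y
    show ρL (x * y) *ᵥ v0 = ρL x *ᵥ (ρL y *ᵥ v0)
    rw [map_mul, Matrix.mulVec_mulVec]
  have hφ01 : φ0 1 = v0 := by
    show ρL 1 *ᵥ v0 = v0
    rw [map_one, Matrix.one_mulVec]
  let φ1 : L →ₗ[ℚ] (Fin n → K) := φ0.toRatLinearMap
  have hinj : Function.Injective φ1 := by
    rw [← LinearMap.ker_eq_bot, LinearMap.ker_eq_bot']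
    intro x hx
    by_contra hx0
    have h1 : φ0 (x⁻¹ * x) = 0 := by
      rw [hφ0mul]
      have : φ0 x = 0 := hx
      rw [this, Matrix.mulVec_zero]
    rw [inv_mul_cancel₀ hx0, hφ01] at h1
    exact hv0 h1
  have hdim : Module.finrank ℚ L = Module.finrank ℚ (Fin n → K) := by
    rw [Module.finrank_pi_fintype, Finset.sum_const, Finset.card_univ, Fintype.card_fin,
      smul_eq_mul, hn, mul_comm, Module.finrank_mul_finrank]
  have hbij : Function.Bijective φ0 :=
    ⟨hinj, (LinearMap.injective_iff_surjective_of_finrank_eq_finrank hdim).mp hinj⟩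
  let φ : L ≃+ (Fin n → K) := AddEquiv.ofBijective φ0 hbij
  have hφ : ∀ x, φ x = φ0 x := fun _ => rfl
  have hmul : ∀ x y, φ (x * y) = ρL x *ᵥ φ y := hφ0mul
  have hσ : ∀ (k : K) (y : L), φ (φ.symm (k • v0) * y) = k • φ y := by
    intro k y
    rw [mul_comm, hmul, AddEquiv.apply_symm_apply, Matrix.mulVec_smul]
    rfl
  refine ⟨{ toFun := fun k => φ.symm (k • v0), map_one' := ?_, map_zero' := ?_, map_mul' := ?_,
            map_add' := ?_ }, φ, ?_, hσ⟩
  · apply φ.injective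
    rw [AddEquiv.apply_symm_apply, one_smul, hφ, hφ01]
  · intro x y
    apply φ.injective
    rw [AddEquiv.apply_symm_apply, hσ, AddEquiv.apply_symm_apply, mul_smul]
  · rw [zero_smul, map_zero]
  · intro x y
    rw [add_smul, map_add]
  · intro γ y
    rw [hmul, hρL]
    rfl

/-- The lattice attached to a coordinate system. -/
def gsLat {n : ℕ} (φ : L ≃+ (Fin n → K)) : Submodule ℤ L :=
  (LinearMap.range ((algebraMap (𝓞 K) K).toAddMonoidHom.compLeft (Fin n)).toIntLinearMap).map
    φ.symm.toAddMonoidHom.toIntLinearMap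

theorem gs_mem_lat {n : ℕ} (φ : L ≃+ (Fin n → K)) (x : L) :
    x ∈ gsLat φ ↔ ∃ w : Fin n → 𝓞 K, ∀ i, φ x i = algebraMap (𝓞 K) K (w i) := by
  constructor
  · rintro ⟨_, ⟨w, rfl⟩, rfl⟩
    refine ⟨w, fun i => ?_⟩
    exact congrFun (φ.apply_symm_apply _) i
  · rintro ⟨w, hw⟩
    refine ⟨_, ⟨w, rfl⟩, ?_⟩
    apply φ.injective
    refine (φ.apply_symm_apply _).trans ?_
    funext i
    exact (hw i).symm

theorem gs_lat_isLattice {n : ℕ} (hn0 : 0 < n) (φ : L ≃+ (Fin n → K))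
    (ρ : Γ →+* Matrix (Fin n) (Fin n) (𝓞 K))
    (h : ∀ (γ : Γ) y, φ (γ * y) = ((ρ γ).map (algebraMap (𝓞 K) K)) *ᵥ φ y) :
    GsLattice Γ (gsLat φ) := by
  refine ⟨?_, ?_, ?_⟩
  · apply Submodule.FG.map
    rw [LinearMap.range_eq_map]
    exact Submodule.FG.map _ Module.Finite.fg_top
  · intro h0
    have h1 : φ.symm (fun _ => 1) ∈ gsLat φ := by
      rw [gs_mem_lat]
      exact ⟨fun _ => 1, fun i => by simp⟩
    rw [h0, Submodule.mem_bot] at h1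
    have h2 := congrArg φ h1
    rw [AddEquiv.apply_symm_apply, map_zero] at h2
    exact one_ne_zero (congrFun h2 ⟨0, hn0⟩)
  · intro γ hγ m hm
    rw [gs_mem_lat] at hm ⊢
    obtain ⟨w, hw⟩ := hm
    refine ⟨ρ ⟨γ, hγ⟩ *ᵥ w, fun i => ?_⟩
    have h1 := h ⟨γ, hγ⟩ m
    have h2 : φ m = fun i => algebraMap (𝓞 K) K (w i) := funext hw
    rw [h2] at h1
    rw [h1]
    simp [Matrix.mulVec, dotProduct, map_sum]

/-- The matrix over `K` of a semilinear change of coordinates. -/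
theorem gs_exists_matrix {n : ℕ} (φ φ' : L ≃+ (Fin n → K)) (σ : K →+* L)
    (hσ : ∀ k y, φ (σ k * y) = k • φ y) (hσ' : ∀ k y, φ' (σ k * y) = k • φ' y)
    (c : L) (hc : ∀ m, m ∈ gsLat φ → c * m ∈ gsLat φ') :
    ∃ U : Matrix (Fin n) (Fin n) (𝓞 K),
      ∀ y, φ' (c * y) = (U.map (algebraMap (𝓞 K) K)) *ᵥ φ y := by
  let u : (Fin n → K) →ₗ[K] (Fin n → K) :=
    { toFun := fun w => φ' (c * φ.symm w)
      map_add' := fun x y => by rw [map_add, mul_add, map_add]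
      map_smul' := fun k x => by
        have : φ.symm (k • x) = σ k * φ.symm x := by
          apply φ.injective
          rw [hσ, AddEquiv.apply_symm_apply, AddEquiv.apply_symm_apply]
        rw [this, mul_left_comm, hσ']
        rfl }
  have hu : ∀ j : Fin n, ∃ w : Fin n → 𝓞 K, ∀ i,
      u (Pi.single j 1) i = algebraMap (𝓞 K) K (w i) := by
    intro j
    apply (gs_mem_lat φ' _).mp
    apply hc
    rw [gs_mem_lat]
    refine ⟨Pi.single j 1, fun i => ?_⟩
    rw [AddEquiv.apply_symm_apply]
    by_cases hij : i = j
    · subst hij; simp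
    · simp [hij]
  choose w hw using hu
  refine ⟨Matrix.of fun i j => w j i, fun y => ?_⟩
  have h1 : (Matrix.of fun i j => w j i).map (algebraMap (𝓞 K) K) = LinearMap.toMatrix' u := by
    ext i j
    rw [LinearMap.toMatrix'_apply, Matrix.map_apply, Matrix.of_apply, ← hw]
  rw [h1, LinearMap.toMatrix'_mulVec]
  show _ = φ' (c * φ.symm (φ y))
  rw [AddEquiv.symm_apply_apply]

theorem gs_matrix_ext {n : ℕ} (φ : L ≃+ (Fin n → K)) (U V : Matrix (Fin n) (Fin n) (𝓞 K))
    (h : ∀ y, (U.map (algebraMap (𝓞 K) K)) *ᵥ φ y = (V.map (algebraMap (𝓞 K) K)) *ᵥ φ y) :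
    U = V := by
  have h1 : U.map (algebraMap (𝓞 K) K) = V.map (algebraMap (𝓞 K) K) := by
    apply Matrix.mulVec_injective
    funext w
    have := h (φ.symm w)
    rwa [AddEquiv.apply_symm_apply] at this
  exact Matrix.map_injective (RingOfIntegers.coe_injective) h1

theorem gs_conj {n : ℕ} (φ φ' : L ≃+ (Fin n → K)) (σ : K →+* L)
    (ρ ρ' : Γ →+* Matrix (Fin n) (Fin n) (𝓞 K))
    (hρ : ∀ (γ : Γ) y, φ (γ * y) = ((ρ γ).map (algebraMap (𝓞 K) K)) *ᵥ φ y)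
    (hρ' : ∀ (γ : Γ) y, φ' (γ * y) = ((ρ' γ).map (algebraMap (𝓞 K) K)) *ᵥ φ' y)
    (hσ : ∀ k y, φ (σ k * y) = k • φ y) (hσ' : ∀ k y, φ' (σ k * y) = k • φ' y)
    (c : L) (hc0 : c ≠ 0) (hc : ∀ m, m ∈ gsLat φ ↔ c * m ∈ gsLat φ') :
    ConjRel Γ (Matrix (Fin n) (Fin n) (𝓞 K)) ρ ρ' := by
  obtain ⟨U, hU⟩ := gs_exists_matrix φ φ' σ hσ hσ' c (fun m hm => (hc m).mp hm)
  obtain ⟨V, hV⟩ := gs_exists_matrix φ' φ σ hσ' hσ c⁻¹ (fun m hm => by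
    rw [hc, mul_inv_cancel_left₀ hc0]; exact hm)
  have hUV : U * V = 1 := by
    apply gs_matrix_ext φ'
    intro y
    rw [Matrix.map_mul, ← Matrix.mulVec_mulVec, ← hV, ← hU, mul_inv_cancel_left₀ hc0]
    simp
  have hVU : V * U = 1 := by
    apply gs_matrix_ext φ
    intro y
    rw [Matrix.map_mul, ← Matrix.mulVec_mulVec, ← hU, ← hV, inv_mul_cancel_left₀ hc0]
    simp
  refine ⟨⟨U, V, hUV, hVU⟩, fun γ => ?_⟩
  have h1 : ρ' γ * U = U * ρ γ := by
    apply gs_matrix_ext φ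
    intro y
    rw [Matrix.map_mul, Matrix.map_mul, ← Matrix.mulVec_mulVec, ← Matrix.mulVec_mulVec, ← hU,
      ← hρ, ← hρ', ← hU, mul_left_comm]
  show ρ' γ = U * ρ γ * V
  rw [← h1, mul_assoc, hUV, mul_one]

end matrices

/-- Let `L` be a number field of degree `g = [L:ℚ]`, `Γ` an order of `L`
with conductor `f`, `K ⊆ L` a subfield with ring of integers `O_K`, `n = [L:K]`, and
`R = Mₙ(O_K)`.  Let `t` be the number of ring homomorphisms `K → L` and `h(Γ)` the
cardinality of the Picard (class) group of the domain `Γ`.  Then the number of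
`Γ`-structures on `R` is at most `N(f)^g · h(Γ) · t`. -/
theorem card_gammaStructures_le
    (L K : Type*) [Field L] [NumberField L] [Field K] [NumberField K] [Algebra K L]
    (Γ : Subring L) (hΓfin : Module.Finite ℤ Γ)
    (hΓspan : Submodule.span ℚ (Γ : Set L) = ⊤)
    (n : ℕ) (hn : n = Module.finrank K L)
    (g : ℕ) (hg : g = Module.finrank ℚ L) :
    Nat.card (Quot (ConjRel Γ (Matrix (Fin n) (Fin n) (𝓞 K)))) ≤
      (Nat.card (𝓞 L ⧸ orderConductor L Γ)) ^ g * Nat.card (ClassGroup Γ) *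
        Nat.card (K →+* L) := by
  classical
  have := gs_finite_quot Γ hΓspan
  have := gs_finite_classGroup Γ hΓfin hΓspan
  have hfinK : Module.Finite K L := Module.Finite.of_restrictScalars_finite ℚ K L
  have hn0 : 0 < n := hn ▸ Module.finrank_pos
  obtain ⟨ι, hι⟩ := gs_exists_embed Γ hΓfin
  have hιinj : Function.Injective ι := by
    intro x y hxy
    apply Subtype.ext
    rw [← hι, ← hι, hxy]
  obtain ⟨F, hF⟩ := gs_exists_injection ι hιinj (orderConductor L Γ)
    (gs_conductor_ne_bot Γ hΓspan) (by
      intro e he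
      refine ⟨⟨algebraMap (𝓞 L) L e, by simpa using he 1⟩, ?_⟩
      apply RingOfIntegers.coe_injective
      exact hι _)
  have hcl : Nat.card (ClassGroup (𝓞 L)) ≤ Nat.card (ClassGroup Γ) :=
    Nat.card_le_card_of_injective F hF
  have hfinKL : Finite (K →+* L) :=
    Finite.of_injective (fun s : K →+* L => s.toRatAlgHom) (by
      intro s t hst
      ext x
      exact DFunLike.congr_fun hst x)
  obtain ⟨Φ, hΦ⟩ := gs_classify Γ hΓspan
  choose σ φ hφ hσ using gs_data (K := K) Γ hΓspan n hn
  let X := Quot (ConjRel Γ (Matrix (Fin n) (Fin n) (𝓞 K)))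
  let Ψ : X → (ClassGroup (𝓞 L) × (Fin (Module.finrank ℚ L) → 𝓞 L ⧸ orderConductor L Γ)) ×
      (K →+* L) := fun q =>
    (Φ ⟨gsLat (φ q.out), gs_lat_isLattice Γ hn0 (φ q.out) q.out (hφ q.out)⟩, σ q.out)
  have hΨ : Function.Injective Ψ := by
    intro p q hpq
    obtain ⟨h1, h2⟩ := Prod.mk.inj hpq
    obtain ⟨c, hc0, hc⟩ := hΦ _ _ h1
    have hσq := hσ q.out
    rw [← h2] at hσq
    have := gs_conj Γ (φ p.out) (φ q.out) (σ p.out) p.out q.out (hφ _) (hφ _) (hσ _) hσq c hc0 hc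
    rw [← Quot.out_eq p, ← Quot.out_eq q]
    exact Quot.sound this
  calc Nat.card X ≤ _ := Nat.card_le_card_of_injective Ψ hΨ
    _ = Nat.card (𝓞 L ⧸ orderConductor L Γ) ^ g * Nat.card (ClassGroup (𝓞 L)) *
        Nat.card (K →+* L) := by
      rw [Nat.card_prod, Nat.card_prod, Nat.card_fun, Nat.card_fin, hg]
      ring
    _ ≤ _ := by gcongr
end

section
/- Let L be a number field, Γ an order of L with conductor f, and O_L the ring of integers of L. Then every fractional ideal I of Γ can be written as I = A·B (product of Γ-submodules of L) where A and B are fractional ideals of Γ such that A is invertible (there exist a fractional ideal A' of Γ and a nonzero x ∈ L with A·A' = x·Γ) and f ⊆ B ⊆ O_L. -/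
open NumberField

open nonZeroDivisors in
lemma aux_ideal (L : Type*) [Field L] [NumberField L] (J : Submodule (𝓞 L) L)
    (hJ : J ≠ ⊥) (hfg : J.FG) (N : 𝓞 L) (hN0 : N ≠ 0) (hN : ¬ IsUnit N) :
    ∃ (x c : L) (e : 𝓞 L) (J1 J2 : Submodule (𝓞 L) L), x ≠ 0 ∧ c ≠ 0 ∧
      c = 1 - (N : L) * (e : L) ∧ (∀ j ∈ J, x * j ∈ J1) ∧ (∀ j ∈ J1, ∃ i ∈ J, j = x * i) ∧
      J1 ≤ 1 ∧ J2 ≤ 1 ∧ c ∈ J1 ∧ c ∈ J2 ∧ J1 * J2 = Submodule.span (𝓞 L) {c} := by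
  let F : FractionalIdeal (𝓞 L)⁰ L := ⟨J, FractionalIdeal.isFractional_of_fg hfg⟩
  have hF : F ≠ 0 := by
    intro h
    apply hJ
    have := congrArg (fun G : FractionalIdeal (𝓞 L)⁰ L => (G : Submodule (𝓞 L) L)) h
    simpa [F] using this
  have hNL : (N : L) ≠ 0 := by simpa using hN0
  obtain ⟨x, hx⟩ := IsDedekindDomain.exists_add_spanSingleton_mul_eq
    (a := FractionalIdeal.spanSingleton (𝓞 L)⁰ (N : L)) (b := F) (c := 1)
    (by rw [FractionalIdeal.spanSingleton_le_iff_mem]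
        exact (FractionalIdeal.mem_one_iff _).2 ⟨N, rfl⟩)
    (FractionalIdeal.spanSingleton_ne_zero_iff.2 hNL) hF
  set F1 := FractionalIdeal.spanSingleton (𝓞 L)⁰ x * F with hF1
  have h1 : (1 : L) ∈ (1 : FractionalIdeal (𝓞 L)⁰ L) := FractionalIdeal.one_mem_one _
  rw [← hx, FractionalIdeal.mem_add] at h1
  obtain ⟨a, ha, c, hc, hac⟩ := h1
  rw [FractionalIdeal.mem_spanSingleton] at ha
  obtain ⟨e, rfl⟩ := ha
  have hce : c = 1 - (N : L) * (e : L) := by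
    rw [← hac, Algebra.smul_def]; ring
  have hc0 : c ≠ 0 := by
    intro h
    apply hN
    refine IsUnit.of_mul_eq_one e ?_
    apply RingOfIntegers.coe_injective
    rw [h] at hce
    push_cast
    linear_combination hce
  have hx0 : x ≠ 0 := by
    intro h
    apply hc0
    rw [hF1, h] at hc
    simpa using hc
  have hF10 : F1 ≠ 0 := by
    rw [hF1]
    exact mul_ne_zero (FractionalIdeal.spanSingleton_ne_zero_iff.2 hx0) hF
  have hF1le : F1 ≤ 1 := by
    rw [← hx]
    exact le_add_of_nonneg_left (zero_le)
  have hcle : FractionalIdeal.spanSingleton (𝓞 L)⁰ c ≤ F1 := by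
    rwa [FractionalIdeal.spanSingleton_le_iff_mem]
  let F2 := FractionalIdeal.spanSingleton (𝓞 L)⁰ c * F1⁻¹
  have h12 : F1 * F2 = FractionalIdeal.spanSingleton (𝓞 L)⁰ c := by
    simp only [F2]
    rw [mul_left_comm, mul_inv_cancel₀ hF10, mul_one]
  have hF2le : F2 ≤ 1 := by
    calc F2 ≤ F1 * F1⁻¹ := mul_le_mul_left hcle _
      _ = 1 := mul_inv_cancel₀ hF10
  have hc2 : c ∈ F2 := by
    rw [← FractionalIdeal.spanSingleton_le_iff_mem, ← h12]
    calc F1 * F2 ≤ 1 * F2 := mul_le_mul_left hF1le _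
      _ = F2 := one_mul _
  refine ⟨x, c, e, F1, F2, hx0, hc0, hce, ?_, ?_, ?_, ?_, hc, hc2, ?_⟩
  · intro j hj
    exact FractionalIdeal.mul_mem_mul (FractionalIdeal.mem_spanSingleton_self _ x)
      (show j ∈ F from hj)
  · intro j hj
    have hj' : j ∈ F1 := hj
    rw [hF1, FractionalIdeal.mem_singleton_mul] at hj'
    exact hj'
  · rw [← FractionalIdeal.coe_one (S := (𝓞 L)⁰) (P := L)]; exact hF1le
  · rw [← FractionalIdeal.coe_one (S := (𝓞 L)⁰) (P := L)]; exact hF2le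
  · rw [← FractionalIdeal.coe_mul, h12, FractionalIdeal.coe_spanSingleton]

lemma aux_int (L : Type*) [Field L] [NumberField L]
    (Γ : Subring L) (hΓspan : Submodule.span ℚ (Γ : Set L) = ⊤) :
    ∃ N : 𝓞 L, N ≠ 0 ∧ ¬ IsUnit N ∧ ∀ y : 𝓞 L, (N : L) * (y : L) ∈ Γ := by
  have h1 : ∀ l : L, ∃ n : ℤ, n ≠ 0 ∧ (n : L) * l ∈ Γ := by
    intro l
    have hl : l ∈ Submodule.span ℚ (Γ : Set L) := by rw [hΓspan]; trivial
    induction hl using Submodule.span_induction with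
    | mem x hx => exact ⟨1, one_ne_zero, by simpa using hx⟩
    | zero => exact ⟨1, one_ne_zero, by simp⟩
    | add x y _ _ hx hy =>
      obtain ⟨n, hn, hn'⟩ := hx
      obtain ⟨m, hm, hm'⟩ := hy
      refine ⟨n * m, mul_ne_zero hn hm, ?_⟩
      have : ((n * m : ℤ) : L) * (x + y) = m * (n * x) + n * (m * y) := by push_cast; ring
      rw [this]
      exact Γ.add_mem (Γ.mul_mem (intCast_mem Γ m) hn') (Γ.mul_mem (intCast_mem Γ n) hm')
    | smul q x _ hx =>
      obtain ⟨n, hn, hn'⟩ := hx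
      refine ⟨q.den * n, mul_ne_zero (by exact_mod_cast q.den_ne_zero) hn, ?_⟩
      have : ((q.den * n : ℤ) : L) * (q • x) = q.num * (n * x) := by
        have h : (q : L) * q.den = q.num := by exact_mod_cast Rat.mul_den_eq_num q
        rw [Rat.smul_def]; push_cast; rw [← h]; ring
      rw [this]
      exact Γ.mul_mem (intCast_mem Γ _) hn'
  choose n hn hn' using h1
  obtain ⟨S, hS⟩ := (Module.Finite.fg_top : (⊤ : Submodule ℤ (𝓞 L)).FG)
  have h2 : ∀ y : 𝓞 L, ((∏ s ∈ S, n (s : L) : ℤ) : L) * (y : L) ∈ Γ := by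
    intro y
    have hy : y ∈ Submodule.span ℤ (S : Set (𝓞 L)) := by rw [hS]; trivial
    induction hy using Submodule.span_induction with
    | mem x hx =>
      classical
      rw [← Finset.prod_erase_mul _ _ hx]
      push_cast
      rw [mul_assoc]
      exact Γ.mul_mem (prod_mem fun _ _ => intCast_mem Γ _) (hn' _)
    | zero => simp
    | add x y _ _ hx hy =>
      rw [show ((x + y : 𝓞 L) : L) = x + y from rfl, mul_add]; exact Γ.add_mem hx hy
    | smul q x _ hx =>
      rw [show ((q • x : 𝓞 L) : L) = q • (x : L) from map_zsmul (algebraMap (𝓞 L) L) q x,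
        mul_smul_comm]
      exact zsmul_mem hx q
  refine ⟨2 * ((∏ s ∈ S, n (s : L) : ℤ) : 𝓞 L), ?_, ?_, ?_⟩
  · refine mul_ne_zero two_ne_zero ?_
    rw [Int.cast_ne_zero]
    exact Finset.prod_ne_zero_iff.2 fun s _ => hn _
  · intro h
    have h2 : IsUnit (2 : 𝓞 L) := isUnit_of_mul_isUnit_left h
    have h3 := h2.map (Algebra.norm ℤ)
    have h4 : Algebra.norm ℤ (2 : 𝓞 L) = 2 ^ Module.finrank ℤ (𝓞 L) := by
      have := Algebra.norm_algebraMap (R := ℤ) (S := 𝓞 L) 2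
      simpa using this
    rw [h4, isUnit_pow_iff (by rw [RingOfIntegers.rank]; exact Module.finrank_pos.ne')] at h3
    revert h3; decide
  · intro y
    have := h2 (2 * y)
    convert this using 1
    push_cast
    simp only [map_ofNat, map_intCast]
    push_cast
    ring

/-- The intersection of an `O_L`-submodule with `Γ`, as a `Γ`-module. -/
def cutSub {L : Type*} [Field L] [NumberField L] (Γ : Subring L)
    (hΓ : ∀ g ∈ Γ, g ∈ integralClosure ℤ L) (J : Submodule (𝓞 L) L) : Submodule Γ L where
  carrier := {a | a ∈ J ∧ a ∈ Γ}
  add_mem' := fun ha hb => ⟨J.add_mem ha.1 hb.1, Γ.add_mem ha.2 hb.2⟩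
  zero_mem' := ⟨J.zero_mem, Γ.zero_mem⟩
  smul_mem' := fun g a ha => ⟨J.smul_mem (⟨g.1, hΓ _ g.2⟩ : 𝓞 L) ha.1, Γ.mul_mem g.2 ha.2⟩

lemma cutSub_fg {L : Type*} [Field L] [NumberField L] (Γ : Subring L)
    (hΓ : ∀ g ∈ Γ, g ∈ integralClosure ℤ L) (hΓfin : Module.Finite ℤ Γ)
    (J : Submodule (𝓞 L) L) : (cutSub Γ hΓ J).FG := by
  have : IsNoetherianRing Γ := isNoetherianRing_iff.2 (isNoetherian_of_tower ℤ inferInstance)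
  have h : cutSub Γ hΓ J ≤ (1 : Submodule Γ L) := by
    intro a ha
    exact Submodule.mem_one.2 ⟨⟨a, ha.2⟩, rfl⟩
  have h1 : (1 : Submodule Γ L).FG := by
    rw [Submodule.one_eq_span]; exact Submodule.fg_span_singleton _
  have := isNoetherian_of_fg_of_noetherian _ h1
  exact Submodule.FG.of_le h1 h

/-- Let `L` be a number field, `Γ` an order of `L` with conductor `f`,
and `O_L` the ring of integers of `L`.  Every fractional ideal `I` of `Γ` (a nonzero
finitely generated `Γ`-submodule of `L`) can be written as `I = A·B` where `A` and `B`
are fractional ideals of `Γ`, `A` is invertible (there are a fractional ideal `A'` and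
a nonzero `x ∈ L` with `A·A' = x·Γ`), and `f ⊆ B ⊆ O_L`. -/
theorem fractionalIdeal_eq_invertible_mul_between_conductor_and_integers
    (L : Type*) [Field L] [NumberField L]
    (Γ : Subring L) (hΓfin : Module.Finite ℤ Γ)
    (hΓspan : Submodule.span ℚ (Γ : Set L) = ⊤)
    (I : Submodule Γ L) (hIne : I ≠ ⊥) (hIfg : I.FG) :
    ∃ A B : Submodule Γ L, (A ≠ ⊥ ∧ A.FG) ∧ (B ≠ ⊥ ∧ B.FG) ∧
      I = A * B ∧
      (∃ A' : Submodule Γ L, (A' ≠ ⊥ ∧ A'.FG) ∧ ∃ x : L, x ≠ 0 ∧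
        ∀ y : L, y ∈ A * A' ↔ ∃ γ ∈ Γ, y = x * γ) ∧
      (∀ z : 𝓞 L, z ∈ orderConductor L Γ → algebraMap (𝓞 L) L z ∈ B) ∧
      (∀ y ∈ B, y ∈ integralClosure ℤ L) := by
  have hΓ : ∀ g ∈ Γ, g ∈ integralClosure ℤ L := by
    intro g hg
    have h : IsIntegral ℤ (⟨g, hg⟩ : Γ) := Algebra.IsIntegral.isIntegral _
    exact h.map (Γ.subtype.toIntAlgHom)
  obtain ⟨N, hN0, hNu, hNΓ⟩ := aux_int L Γ hΓspan
  obtain ⟨T, hT⟩ := hIfg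
  have hTI : ∀ i ∈ I, i ∈ Submodule.span (𝓞 L) (T : Set L) := by
    intro i hi
    rw [← hT] at hi
    induction hi using Submodule.span_induction with
    | mem x hx => exact Submodule.subset_span hx
    | zero => exact Submodule.zero_mem _
    | add x y _ _ hx hy => exact Submodule.add_mem _ hx hy
    | smul g x _ hx => exact Submodule.smul_mem _ (⟨g.1, hΓ _ g.2⟩ : 𝓞 L) hx
  have hIT : ∀ t ∈ T, t ∈ I := fun t ht => hT ▸ Submodule.subset_span ht
  obtain ⟨x, c, e, J1, J2, hx0, hc0, hce, hJ1, hJ1', hJ1le, hJ2le, hc1, hc2, h12⟩ :=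
    aux_ideal L (Submodule.span (𝓞 L) (T : Set L)) (by
      obtain ⟨i, hi, hi0⟩ := Submodule.exists_mem_ne_zero_of_ne_bot hIne
      exact fun h => hi0 (by simpa [h] using hTI i hi)) ⟨T, rfl⟩ N hN0 hNu
  have hI1 : ∀ j ∈ J1, ∃ o : 𝓞 L, (o : L) = j := fun j hj => Submodule.mem_one.1 (hJ1le hj)
  have hI2 : ∀ j ∈ J2, ∃ o : 𝓞 L, (o : L) = j := fun j hj => Submodule.mem_one.1 (hJ2le hj)
  have hcΓ : c ∈ Γ := by rw [hce]; exact Γ.sub_mem Γ.one_mem (hNΓ e)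
  have osm : ∀ (J : Submodule (𝓞 L) L) (o : 𝓞 L) (j : L), j ∈ J → (o : L) * j ∈ J :=
    fun J o j hj => J.smul_mem o hj
  set A0 := cutSub Γ hΓ J1 with hA0
  set A0' := cutSub Γ hΓ J2 with hA0'
  have hcA0 : c ∈ A0 := ⟨hc1, hcΓ⟩
  have hcA0' : c ∈ A0' := ⟨hc2, hcΓ⟩
  have hNA0 : ∀ j ∈ J1, (N : L) * j ∈ A0 := by
    intro j hj
    obtain ⟨o, rfl⟩ := hI1 j hj
    exact ⟨osm _ _ _ hj, hNΓ o⟩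
  have hNA0' : ∀ j ∈ J2, (N : L) * j ∈ A0' := by
    intro j hj
    obtain ⟨o, rfl⟩ := hI2 j hj
    exact ⟨osm _ _ _ hj, hNΓ o⟩
  have hNprod : ∀ a ∈ J1 * J2, (N : L) * a ∈ A0 * A0' := by
    intro a ha
    induction ha using Submodule.mul_induction_on' with
    | mem_mul_mem a ha b hb =>
      have : (N : L) * (a * b) = (N * (b * a)) * c + (N * a) * (N * (e * b)) := by
        rw [hce]; ring
      rw [this]
      obtain ⟨o, rfl⟩ := hI2 b hb
      exact Submodule.add_mem _ (Submodule.mul_mem_mul (hNA0 _ (osm _ _ _ ha)) hcA0')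
        (Submodule.mul_mem_mul (hNA0 _ ha) (hNA0' _ (osm _ _ _ hb)))
    | add a _ b _ ha hb => rw [mul_add]; exact Submodule.add_mem _ ha hb
  have hAA : A0 * A0' = Submodule.span Γ {c} := by
    apply le_antisymm
    · rw [Submodule.mul_le]
      intro a ha b hb
      have h : a * b ∈ J1 * J2 := Submodule.mul_mem_mul ha.1 hb.1
      rw [h12, Submodule.mem_span_singleton] at h
      obtain ⟨z, hz⟩ := h
      have hz' : (z : L) * c = a * b := hz
      have hzΓ : (z : L) ∈ Γ := by
        have : (z : L) = a * b + N * ((e * z : 𝓞 L) : L) := by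
          rw [← hz', hce]; push_cast; ring
        rw [this]
        exact Γ.add_mem (Γ.mul_mem ha.2 hb.2) (hNΓ _)
      rw [← hz']
      exact Submodule.mem_span_singleton.2 ⟨⟨z, hzΓ⟩, rfl⟩
    · rw [Submodule.span_singleton_le_iff_mem]
      have : c = c * c + N * (e * c) := by
        nth_rewrite 1 [← one_mul c]
        have : (1 : L) = c + N * e := by rw [hce]; ring
        rw [this]; ring
      rw [this]
      refine Submodule.add_mem _ (Submodule.mul_mem_mul hcA0 hcA0') (hNprod _ ?_)
      rw [h12]
      exact osm _ _ _ (Submodule.mem_span_singleton_self c)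
  have ne_bot : ∀ (M : Submodule Γ L) (m : L), m ∈ M → m ≠ 0 → M ≠ ⊥ := by
    intro M m hm hm0 h
    rw [h] at hm
    exact hm0 (by simpa using hm)
  have self := fun y : L => Submodule.mem_span_singleton_self (R := Γ) y
  have key : Submodule.span Γ {x⁻¹} * A0 * (Submodule.span Γ {x / c} * (A0' * I)) = I := by
    calc _ = (Submodule.span Γ {x⁻¹} * Submodule.span Γ {x / c}) * (A0 * A0') * I := by ac_rfl
      _ = I := by
        rw [hAA, Submodule.span_mul_span, Submodule.span_mul_span, Set.singleton_mul_singleton,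
          Set.singleton_mul_singleton]
        have : x⁻¹ * (x / c) * c = 1 := by field_simp
        rw [this, ← Submodule.one_eq_span, one_mul]
  have hBint : ∀ a ∈ A0', ∀ i ∈ I, ∃ z : 𝓞 L, (z : L) * c = x * (a * i) := by
    intro a ha i hi
    have h : x * i * a ∈ J1 * J2 := Submodule.mul_mem_mul (hJ1 _ (hTI i hi)) ha.1
    rw [h12, Submodule.mem_span_singleton] at h
    obtain ⟨z, hz⟩ := h
    exact ⟨z, by rw [show (z : L) * c = x * i * a from hz]; ring⟩
  obtain ⟨i0, hi0, hi00⟩ := Submodule.exists_mem_ne_zero_of_ne_bot hIne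
  refine ⟨Submodule.span Γ {x⁻¹} * A0, Submodule.span Γ {x / c} * (A0' * I),
    ⟨?_, ?_⟩, ⟨?_, ?_⟩, key.symm, ⟨A0', ⟨?_, ?_⟩, x⁻¹ * c, ?_, ?_⟩, ?_, ?_⟩
  · exact ne_bot _ (x⁻¹ * c) (Submodule.mul_mem_mul (self _) hcA0)
      (mul_ne_zero (inv_ne_zero hx0) hc0)
  · exact (Submodule.fg_span_singleton _).mul (cutSub_fg Γ hΓ hΓfin J1)
  · exact ne_bot _ (x / c * (c * i0))
      (Submodule.mul_mem_mul (self _) (Submodule.mul_mem_mul hcA0' hi0))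
      (mul_ne_zero (div_ne_zero hx0 hc0) (mul_ne_zero hc0 hi00))
  · exact (Submodule.fg_span_singleton _).mul ((cutSub_fg Γ hΓ hΓfin J2).mul ⟨T, hT⟩)
  · exact ne_bot _ c hcA0' hc0
  · exact cutSub_fg Γ hΓ hΓfin J2
  · exact mul_ne_zero (inv_ne_zero hx0) hc0
  · intro y
    rw [mul_assoc, hAA, Submodule.span_mul_span, Set.singleton_mul_singleton,
      Submodule.mem_span_singleton]
    constructor
    · rintro ⟨g, rfl⟩
      exact ⟨g, g.2, mul_comm _ _⟩
    · rintro ⟨g, hg, rfl⟩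
      exact ⟨⟨g, hg⟩, mul_comm _ _⟩
  · intro z hz
    have hzΓ : ∀ y : 𝓞 L, (z : L) * (y : L) ∈ Γ := fun y => by
      have := hz y
      rwa [map_mul] at this
    have hb : ∀ b ∈ J2, ∀ j ∈ Submodule.span (𝓞 L) (T : Set L), ∀ o : 𝓞 L,
        (z : L) * (o * b * j) ∈ A0' * I := by
      intro b hb j hj
      induction hj using Submodule.span_induction with
      | mem t ht =>
        intro o
        rw [← mul_assoc]
        refine Submodule.mul_mem_mul ⟨osm _ _ _ (osm _ _ _ hb), ?_⟩ (hIT t ht)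
        obtain ⟨b, rfl⟩ := hI2 b hb
        rw [← map_mul]
        exact hzΓ _
      | zero => intro o; simp
      | add u v _ _ hu hv => intro o; rw [mul_add, mul_add]; exact Submodule.add_mem _ (hu o) (hv o)
      | smul w u _ hu =>
        intro o
        have := hu (o * w)
        rw [show ((o * w : 𝓞 L) : L) = o * w from rfl] at this
        rw [Algebra.smul_def]
        convert this using 1
        ring
    have hall : ∀ a ∈ J1 * J2, (z : L) * (x⁻¹ * a) ∈ A0' * I := by
      intro a ha
      induction ha using Submodule.mul_induction_on' with
      | mem_mul_mem a ha b hb' =>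
        obtain ⟨i, hi, rfl⟩ := hJ1' a ha
        have := hb b hb' i hi 1
        rw [show ((1 : 𝓞 L) : L) = 1 from rfl] at this
        convert this using 1
        field_simp
      | add a _ b _ ha hb => rw [mul_add, mul_add]; exact Submodule.add_mem _ ha hb
    have hfin := hall c (by rw [h12]; exact Submodule.mem_span_singleton_self c)
    have : (z : L) = x / c * (z * (x⁻¹ * c)) := by field_simp
    change (z : L) ∈ _
    rw [this]
    exact Submodule.mul_mem_mul (self _) hfin
  · intro y hy
    rw [Submodule.mem_span_singleton_mul] at hy
    obtain ⟨w, hw, rfl⟩ := hy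
    induction hw using Submodule.mul_induction_on' with
    | mem_mul_mem a ha i hi =>
      obtain ⟨z, hz⟩ := hBint a ha i hi
      have : x / c * (a * i) = z := by
        field_simp
        rw [mul_assoc, ← hz]; ring
      rw [this]
      exact z.2
    | add a _ b _ ha hb => rw [mul_add]; exact add_mem ha hb
end

section
/- Let Γ be an order of a number field, and let R be an associative unital ring whose underlying ℤ-module is finitely generated and torsion-free, and such that the ℚ-algebra R ⊗_ℤ ℚ is semisimple. Then there are only finitely many Γ-structures on R, i.e. the set of unital ring homomorphisms Γ → R modulo conjugation by units of R is finite. -/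
open scoped TensorProduct

namespace JZ

/-- A `Λ`-lattice in `V`. -/
def IsLat {B : Type*} [Ring B] {Λ : Subring B} {V : Type*} [AddCommGroup V] [Module B V]
    (M : Submodule Λ V) : Prop :=
  Module.Finite ℤ M ∧ ∀ v : V, ∃ n : ℕ, n ≠ 0 ∧ n • v ∈ M

/-- Transport of a lattice along a `B`-linear equivalence. -/
def tr {B : Type*} [Ring B] {Λ : Subring B} {V V' : Type*} [AddCommGroup V] [Module B V]
    [AddCommGroup V'] [Module B V'] (g : V ≃ₗ[B] V') (M : Submodule Λ V) : Submodule Λ V' where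
  carrier := {y | g.symm y ∈ M}
  add_mem' := fun {a b} ha hb => by
    simp only [Set.mem_ofPred_eq, map_add] at *
    exact M.add_mem ha hb
  zero_mem' := by simp
  smul_mem' := fun c x hx => by
    simp only [Set.mem_ofPred_eq, Subring.smul_def, map_smul] at *
    exact M.smul_mem c hx

/-- Jordan–Zassenhaus property for `V`. -/
def JZP {B : Type*} [Ring B] (Λ : Subring B) (V : Type*) [AddCommGroup V] [Module B V] : Prop :=
  ∃ S : Set (Submodule Λ V), S.Finite ∧ ∀ M : Submodule Λ V, IsLat M →
    ∃ g : V ≃ₗ[B] V, tr g M ∈ S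

section basic

variable {B : Type*} [Ring B] {Λ : Subring B} {V V' : Type*} [AddCommGroup V] [Module B V]
    [AddCommGroup V'] [Module B V']

@[simp] lemma mem_tr (g : V ≃ₗ[B] V') (M : Submodule Λ V) (y : V') :
    y ∈ tr g M ↔ g.symm y ∈ M := Iff.rfl

lemma tr_tr {V'' : Type*} [AddCommGroup V''] [Module B V''] (g : V ≃ₗ[B] V') (h : V' ≃ₗ[B] V'')
    (M : Submodule Λ V) : tr h (tr g M) = tr (g.trans h) M := by
  ext; simp

/-- additive equivalence -/
def trEquiv (g : V ≃ₗ[B] V') (M : Submodule Λ V) : M ≃+ tr g M where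
  toFun x := ⟨g x, by simp⟩
  invFun y := ⟨g.symm y, y.2⟩
  left_inv x := by simp
  right_inv x := by simp
  map_add' x y := by ext; simp

lemma IsLat.tr {M : Submodule Λ V} (h : IsLat M) (g : V ≃ₗ[B] V') : IsLat (tr g M) := by
  refine ⟨?_, fun v => ?_⟩
  · have := h.1
    exact Module.Finite.equiv (trEquiv g M).toIntLinearEquiv
  · obtain ⟨n, hn, h'⟩ := h.2 (g.symm v)
    exact ⟨n, hn, by simpa using h'⟩

lemma JZP.congr (g : V ≃ₗ[B] V') (h : JZP Λ V) : JZP Λ V' := by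
  obtain ⟨S, hS, H⟩ := h
  refine ⟨tr g '' S, hS.image _, fun M hM => ?_⟩
  obtain ⟨a, ha⟩ := H _ (hM.tr g.symm)
  refine ⟨(g.symm.trans a).trans g, tr a (tr g.symm M), ha, ?_⟩
  simp [tr_tr]

/-- finite quotient modulo `n`: representatives -/
lemma exists_reps {G : Type*} [AddCommGroup G] [Module.Finite ℤ G] (H : AddSubgroup G)
    (hH : ∀ x : G, ∃ n : ℕ, n ≠ 0 ∧ n • x ∈ H) : Finite (G ⧸ H) := by
  have : Module.Finite ℤ (G ⧸ H) :=
    Module.Finite.of_surjective (QuotientAddGroup.mk' H).toIntLinearMap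
      (QuotientAddGroup.mk'_surjective H)
  refine Module.finite_of_fg_torsion _ ?_
  intro x
  induction x using QuotientAddGroup.induction_on with
  | H x =>
    obtain ⟨n, hn, h⟩ := hH x
    refine ⟨⟨(n : ℤ), by simpa using hn⟩, ?_⟩
    change (n : ℤ) • (x : G ⧸ H) = 0
    rw [natCast_zsmul, ← QuotientAddGroup.mk_nsmul]
    exact (QuotientAddGroup.eq_zero_iff _).2 h

lemma finite_between [IsAddTorsionFree V] (N : Submodule Λ V) (hN : Module.Finite ℤ N) (C : ℕ)
    (hC : C ≠ 0) : {M : Submodule Λ V | N ≤ M ∧ ∀ x ∈ M, C • x ∈ N}.Finite := by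
  let H : AddSubgroup N := (nsmulAddMonoidHom (α := N) C).range
  have hfin : Finite (N ⧸ H) := exists_reps H fun x => ⟨C, hC, x, rfl⟩
  let F : Submodule Λ V → Set (N ⧸ H) := fun M => {q | ∃ x : N, (x : N ⧸ H) = q ∧ ∃ m ∈ M, C • m = (x : V)}
  refine Set.Finite.of_finite_image (f := F) (Set.toFinite _) ?_
  have key : ∀ M M' : Submodule Λ V, (N ≤ M ∧ ∀ x ∈ M, C • x ∈ N) →
      (N ≤ M' ∧ ∀ x ∈ M', C • x ∈ N) → F M = F M' → M ≤ M' := by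
    intro M M' hM hM' h x hx
    have : ((⟨C • x, hM.2 x hx⟩ : N) : N ⧸ H) ∈ F M := ⟨_, rfl, x, hx, rfl⟩
    rw [h] at this
    obtain ⟨y, hy, m, hm, hmy⟩ := this
    rw [QuotientAddGroup.eq] at hy
    obtain ⟨z, hz⟩ := hy
    have hz' : C • (z : V) = - (y : V) + C • x := congrArg Subtype.val hz
    have : C • x = C • (m + z) := by rw [smul_add, hz', hmy]; abel
    rw [nsmul_right_injective hC this]
    exact M'.add_mem hm (hM'.1 z.2)
  intro M hM M' hM' h
  exact le_antisymm (key M M' hM hM' h) (key M' M hM' hM h.symm)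

end basic


section prodstep

variable {B : Type*} [Ring B] [Algebra ℚ B] {Λ : Subring B} {W U : Type*} [AddCommGroup W] [Module B W]
    [AddCommGroup U] [Module B U]

lemma inv_nsmul {n : ℕ} (hn : n ≠ 0) (u : U) :
    (algebraMap ℚ B (n : ℚ)⁻¹) • n • u = u := by
  have e : n • u = (algebraMap ℚ B (n : ℚ)) • u := by
    rw [map_natCast, Nat.cast_smul_eq_nsmul]
  rw [e, smul_smul, ← map_mul, inv_mul_cancel₀ (by exact_mod_cast hn), map_one, one_smul]

/-- common denominators -/
lemma common_den (hden : ∀ b : B, ∃ n : ℕ, n ≠ 0 ∧ n • b ∈ Λ) {ι : Type*} [Finite ι]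
    (b : ι → B) : ∃ n : ℕ, n ≠ 0 ∧ ∀ i, n • b i ∈ Λ := by
  classical
  cases nonempty_fintype ι
  choose n hn h using fun i => hden (b i)
  refine ⟨∏ i, n i, Finset.prod_ne_zero_iff.2 fun i _ => hn i, fun i => ?_⟩
  rw [← Finset.prod_erase_mul _ _ (Finset.mem_univ i), mul_smul]
  exact Λ.nsmul_mem (h i) _

/-- shear automorphism -/
def shear (h : U →ₗ[B] W) : (W × U) ≃ₗ[B] (W × U) where
  toFun x := (x.1 - h x.2, x.2)
  invFun x := (x.1 + h x.2, x.2)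
  map_add' x y := by ext <;> simp; abel
  map_smul' c x := by ext <;> simp [smul_sub]
  left_inv x := by simp
  right_inv x := by simp

lemma prod_fixed [IsSemisimpleRing B] [IsAddTorsionFree W] [IsAddTorsionFree U]
    (hden : ∀ b : B, ∃ n : ℕ, n ≠ 0 ∧ n • b ∈ Λ)
    (N₁ : Submodule Λ W) (N₂ : Submodule Λ U) (h₁ : IsLat N₁) (h₂ : IsLat N₂) :
    ∃ S : Set (Submodule Λ (W × U)), S.Finite ∧ ∀ M : Submodule Λ (W × U),
      (∀ w, (w, (0 : U)) ∈ M ↔ w ∈ N₁) → (∀ u, u ∈ N₂ ↔ ∃ w, (w, u) ∈ M) →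
      ∃ g : (W × U) ≃ₗ[B] (W × U), tr g M ∈ S := by
  classical
  have hf1 := h₁.1
  have hf2 := h₂.1
  obtain ⟨s, hs⟩ := hf2.fg_top
  let y : s → U := fun i => ((i : N₂) : U)
  have hy : ∀ i, y i ∈ N₂ := fun i => (i : N₂).2
  let p : (s →₀ B) →ₗ[B] U := Finsupp.linearCombination B y
  -- generation
  have hgen : ∀ (P : AddSubgroup U), (∀ i, y i ∈ P) → ∀ u ∈ N₂, u ∈ P := by
    intro P hP u hu
    have : (⟨u, hu⟩ : N₂) ∈ Submodule.span ℤ (s : Set N₂) := by rw [hs]; trivial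
    refine Submodule.span_induction (p := fun (x : N₂) _ => (x : U) ∈ P) ?_ ?_ ?_ ?_ this
    · intro x hx; exact hP ⟨x, hx⟩
    · exact P.zero_mem
    · intro a b _ _ ha hb; exact P.add_mem ha hb
    · intro n a _ ha; exact P.zsmul_mem ha n
  have hp : Function.Surjective p := by
    intro u
    obtain ⟨n, hn, hu⟩ := h₂.2 u
    have : n • u ∈ LinearMap.range p :=
      hgen (LinearMap.range p).toAddSubgroup
        (fun i => ⟨Finsupp.single i 1, by simp [p]⟩) _ hu
    have := (LinearMap.range p).smul_mem (algebraMap ℚ B (n : ℚ)⁻¹) this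
    rwa [inv_nsmul hn] at this
  have := Module.projective_of_isSemisimpleRing B U
  obtain ⟨j, hj⟩ := Module.projective_lifting_property p LinearMap.id hp
  obtain ⟨m, hm0, hm⟩ := common_den hden (fun q : s × s => j (y q.1) q.2)
  have hmj : ∀ u ∈ N₂, ∀ l, m • (j u l) ∈ Λ := by
    intro u hu l
    let P : AddSubgroup U := Λ.toAddSubgroup.comap
      ((nsmulAddMonoidHom m).comp ((Finsupp.applyAddHom l).comp j.toAddMonoidHom))
    exact hgen P (fun i => hm (i, l)) u hu
  let N : Submodule Λ (W × U) :=
    { carrier := {x | x.1 ∈ N₁ ∧ ∃ u ∈ N₂, x.2 = m • u}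
      add_mem' := by
        rintro a b ⟨ha, u, hu, e⟩ ⟨hb, u', hu', e'⟩
        exact ⟨N₁.add_mem ha hb, u + u', N₂.add_mem hu hu', by simp [e, e']⟩
      zero_mem' := ⟨N₁.zero_mem, 0, N₂.zero_mem, by simp⟩
      smul_mem' := by
        rintro c a ⟨ha, u, hu, e⟩
        exact ⟨N₁.smul_mem c ha, c • u, N₂.smul_mem c hu, by
          rw [Prod.smul_snd, e, smul_comm]⟩ }
  have hNf : Module.Finite ℤ N := by
    let φ : (N₁ × N₂) →+ N :=
      { toFun := fun x => ⟨(x.1, m • (x.2 : U)), x.1.2, x.2, x.2.2, rfl⟩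
        map_zero' := by ext <;> simp
        map_add' := fun a b => by ext <;> simp }
    refine Module.Finite.of_surjective φ.toIntLinearMap ?_
    rintro ⟨⟨a, b⟩, ha, u, hu, e⟩
    refine ⟨(⟨a, ha⟩, ⟨u, hu⟩), ?_⟩
    simp only at e
    subst e
    rfl
  refine ⟨_, finite_between N hNf m hm0, fun M hM1 hM2 => ?_⟩
  choose z hz using fun i => (hM2 (y i)).1 (hy i)
  let pt : (s →₀ B) →ₗ[B] W := Finsupp.linearCombination B z
  let h : U →ₗ[B] W := pt.comp j
  have hsM : ∀ u ∈ N₂, (m • h u, m • u) ∈ M := by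
    intro u hu
    have e : (m • h u, m • u) = ∑ l : s, (⟨m • j u l, hmj u hu l⟩ : Λ) • ((z l, y l) : W × U) := by
      have e2 : u = p (j u) := (LinearMap.congr_fun hj u).symm
      have e3 : p (j u) = ∑ l, (j u l) • y l := by
        simp only [p, Finsupp.linearCombination_apply]
        exact Finsupp.sum_fintype _ _ (by simp)
      have e4 : h u = ∑ l, (j u l) • z l := by
        simp only [h, pt, LinearMap.comp_apply, Finsupp.linearCombination_apply]
        exact Finsupp.sum_fintype _ _ (by simp)
      have e5 : u = ∑ l, (j u l) • y l := e2.trans e3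
      rw [e4]
      refine Prod.ext ?_ ?_
      · simp [Prod.fst_sum, Subring.smul_def, Finset.smul_sum, mul_smul, Nat.cast_smul_eq_nsmul]
      · rw [Prod.snd_sum]
        simp only [Subring.smul_def, Prod.smul_snd]
        conv_lhs => rw [e5]
        simp [Finset.smul_sum, mul_smul, Nat.cast_smul_eq_nsmul]
    rw [e]
    exact M.sum_mem fun l _ => M.smul_mem _ (hz l)
  refine ⟨shear h, ?_, ?_⟩
  · rintro ⟨w, u⟩ ⟨hw, u', hu', e⟩
    simp only at e hw
    subst e
    change (w + h (m • u'), m • u') ∈ M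
    have := M.add_mem ((hM1 w).2 hw) (hsM u' hu')
    simpa using this
  · rintro ⟨w, u⟩ hx
    change (w + h u, u) ∈ M at hx
    have hu := (hM2 u).2 ⟨_, hx⟩
    refine ⟨?_, u, hu, rfl⟩
    rw [Prod.smul_fst, ← hM1]
    have := M.sub_mem (M.nsmul_mem hx m) (hsM u hu)
    simpa using this

lemma JZP.prod [IsSemisimpleRing B] [IsAddTorsionFree W] [IsAddTorsionFree U]
    (hden : ∀ b : B, ∃ n : ℕ, n ≠ 0 ∧ n • b ∈ Λ) (hW : JZP Λ W) (hU : JZP Λ U) :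
    JZP Λ (W × U) := by
  classical
  obtain ⟨S₁, hS₁, H₁⟩ := hW
  obtain ⟨S₂, hS₂, H₂⟩ := hU
  have key : ∀ N : Submodule Λ W × Submodule Λ U, ∃ S : Set (Submodule Λ (W × U)), S.Finite ∧
      (IsLat N.1 → IsLat N.2 → ∀ M : Submodule Λ (W × U),
      (∀ w, (w, (0 : U)) ∈ M ↔ w ∈ N.1) → (∀ u, u ∈ N.2 ↔ ∃ w, (w, u) ∈ M) →
      ∃ g : (W × U) ≃ₗ[B] (W × U), tr g M ∈ S) := by
    intro N
    by_cases h : IsLat N.1 ∧ IsLat N.2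
    · obtain ⟨S, hS, H⟩ := prod_fixed hden N.1 N.2 h.1 h.2
      exact ⟨S, hS, fun _ _ => H⟩
    · exact ⟨∅, Set.finite_empty, fun h1 h2 => absurd ⟨h1, h2⟩ h⟩
  choose S hS H using key
  refine ⟨⋃ N ∈ S₁ ×ˢ S₂, S N, (hS₁.prod hS₂).biUnion fun N _ => hS N, fun M hM => ?_⟩
  have hMf := hM.1
  let M₁ : Submodule Λ W := M.comap (LinearMap.inl Λ W U)
  let M₂ : Submodule Λ U := M.map (LinearMap.snd Λ W U)
  have hM₁ : IsLat M₁ := by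
    constructor
    · let φ : M₁ →+ M :=
        { toFun := fun x => ⟨(x, 0), x.2⟩
          map_zero' := rfl
          map_add' := fun a b => by ext <;> simp }
      refine Module.Finite.of_injective φ.toIntLinearMap ?_
      intro a b hab
      have := congrArg (fun t : M => (t : W × U).1) hab
      exact Subtype.ext this
    · intro v
      obtain ⟨n, hn, h⟩ := hM.2 (v, 0)
      exact ⟨n, hn, by simpa [M₁] using h⟩
  have hM₂ : IsLat M₂ := by
    constructor
    · let φ : M →+ M₂ :=
        { toFun := fun x => ⟨(x : W × U).2, x, x.2, rfl⟩
          map_zero' := rfl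
          map_add' := fun a b => by ext; simp }
      refine Module.Finite.of_surjective φ.toIntLinearMap ?_
      rintro ⟨_, x, hx, rfl⟩
      exact ⟨⟨x, hx⟩, rfl⟩
    · intro v
      obtain ⟨n, hn, h⟩ := hM.2 (0, v)
      exact ⟨n, hn, _, h, by simp⟩
  obtain ⟨g₁, hg₁⟩ := H₁ M₁ hM₁
  obtain ⟨g₂, hg₂⟩ := H₂ M₂ hM₂
  let G : (W × U) ≃ₗ[B] (W × U) := LinearEquiv.prodCongr g₁ g₂
  obtain ⟨g, hg⟩ := H (tr g₁ M₁, tr g₂ M₂) (hM₁.tr g₁) (hM₂.tr g₂) (tr G M)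
    (by intro w; simp [G, M₁])
    (by
      intro u
      constructor
      · rintro ⟨x, hx, e⟩
        refine ⟨g₁ x.1, ?_⟩
        have e' : x.2 = g₂.symm u := e
        simp [G, ← e']
        exact hx
      · rintro ⟨w, hw⟩
        exact ⟨_, hw, by simp [G]⟩)
  refine ⟨G.trans g, ?_⟩
  rw [← tr_tr]
  exact Set.mem_biUnion (Set.mk_mem_prod hg₁ hg₂) hg

end prodstep

end JZ

namespace JZ

section counting

lemma greedy {E V A : Type*} [DivisionRing E] [AddCommGroup V] [Module E V] [Module.Finite E V]
    (T : A → V →ₗ[E] E) (hsep : ∀ v, (∀ a, T a v = 0) → v = 0) :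
    ∃ (r : ℕ) (a : Fin r → A), Function.Bijective (LinearMap.pi (fun i => T (a i))) := by
  by_contra hcon
  push Not at hcon
  have key : ∀ r : ℕ, ∃ a : Fin r → A, Function.Surjective (LinearMap.pi (fun i => T (a i))) := by
    intro r
    induction r with
    | zero => exact ⟨Fin.elim0, fun y => ⟨0, Subsingleton.elim _ _⟩⟩
    | succ r ih =>
      obtain ⟨a, ha⟩ := ih
      have hni : ¬ Function.Injective (LinearMap.pi (fun i => T (a i))) :=
        fun h => hcon r a ⟨h, ha⟩
      rw [← LinearMap.ker_eq_bot, Submodule.eq_bot_iff] at hni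
      push Not at hni
      obtain ⟨v, hv, hv0⟩ := hni
      have : ∃ b, T b v ≠ 0 := by
        by_contra h
        push Not at h
        exact hv0 (hsep v h)
      obtain ⟨b, hb⟩ := this
      refine ⟨Fin.cons b a, fun y => ?_⟩
      obtain ⟨w, hw⟩ := ha (fun i => y i.succ)
      refine ⟨w + ((y 0 - T b w) * (T b v)⁻¹) • v, ?_⟩
      have hv' : ∀ i, T (a i) v = 0 := fun i => congrFun (LinearMap.mem_ker.1 hv) i
      have hw' : ∀ i, T (a i) w = y i.succ := fun i => congrFun hw i
      ext i
      refine Fin.cases ?_ (fun i => ?_) i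
      · simp [hb]
      · simp [hv', hw']
  obtain ⟨a, ha⟩ := key (Module.finrank E V + 1)
  have := LinearMap.finrank_le_finrank_of_surjective ha
  simp at this

lemma pigeon {G ι : Type*} [AddCommGroup G] [Fintype ι] [Nonempty ι] (b : Module.Basis ι ℤ G)
    (H : AddSubgroup G) [Finite (G ⧸ H)] :
    ∃ s : ℕ, s ≠ 0 ∧ s ^ Fintype.card ι ≤ H.index ∧ ∃ c : ι → ℤ, c ≠ 0 ∧ (∀ i, |c i| ≤ s) ∧
      ∑ i, c i • b i ∈ H := by
  classical
  have hidx : H.index ≠ 0 := by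
    rw [AddSubgroup.index]; exact Nat.card_pos.ne'
  have hd : Fintype.card ι ≠ 0 := Fintype.card_ne_zero
  let s := Nat.findGreatest (fun s => s ^ Fintype.card ι ≤ H.index) H.index
  have hs1 : 1 ≤ s := Nat.le_findGreatest (Nat.one_le_iff_ne_zero.2 hidx)
    (by rw [one_pow]; exact Nat.one_le_iff_ne_zero.2 hidx)
  have hs2 : s ^ Fintype.card ι ≤ H.index :=
    Nat.findGreatest_spec (P := fun s => s ^ Fintype.card ι ≤ H.index)
      (Nat.one_le_iff_ne_zero.2 hidx) (by rw [one_pow]; exact Nat.one_le_iff_ne_zero.2 hidx)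
  have hs3 : H.index < (s + 1) ^ Fintype.card ι := by
    by_contra h
    push Not at h
    have h2 : s + 1 ≤ H.index := (Nat.le_self_pow hd _).trans h
    have := Nat.le_findGreatest (P := fun s => s ^ Fintype.card ι ≤ H.index) h2 h
    change s + 1 ≤ s at this
    omega
  refine ⟨s, by omega, hs2, ?_⟩
  cases nonempty_fintype (G ⧸ H)
  let F : (ι → Fin (s + 1)) → G ⧸ H := fun c => ((∑ i, ((c i : ℕ) : ℤ) • b i : G) : G ⧸ H)
  obtain ⟨c, c', hne, hF⟩ := Fintype.exists_ne_map_eq_of_card_lt F (by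
    rw [Fintype.card_fun, Fintype.card_fin, ← Nat.card_eq_fintype_card (α := G ⧸ H)]
    exact hs3)
  refine ⟨fun i => ((c' i : ℕ) : ℤ) - ((c i : ℕ) : ℤ), ?_, ?_, ?_⟩
  · intro h
    apply hne
    ext i
    have := congrFun h i
    simp only [Pi.zero_apply] at this
    omega
  · intro i
    have := (c i).2
    have := (c' i).2
    simp only [abs_le]
    constructor <;> omega
  · have := QuotientAddGroup.eq.1 hF
    simp only [sub_smul, Finset.sum_sub_distrib]
    rwa [neg_add_eq_sub] at this

lemma index_range_eq {G : Type*} [AddCommGroup G] [Module.Free ℤ G] [Module.Finite ℤ G]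
    (φ : G →ₗ[ℤ] G) (hφ : Function.Injective φ) :
    φ.toAddMonoidHom.range.index = (LinearMap.det φ).natAbs := by
  have := Submodule.natAbs_det_equiv (LinearMap.range φ) (LinearEquiv.ofInjective φ hφ)
  have e : ((LinearMap.range φ).subtype ∘ₗ AddMonoidHom.toIntLinearMap
    ((LinearEquiv.ofInjective φ hφ : G ≃ₗ[ℤ] _) : G →+ LinearMap.range φ)) = φ := by
    ext x; simp
  rw [e] at this
  rw [this]
  rfl

/-- The determinant bound for integral combinations of endomorphisms. -/
lemma det_bound {G ι : Type*} [AddCommGroup G] [Module.Free ℤ G] [Module.Finite ℤ G] [Fintype ι]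
    (μ : ι → Module.End ℤ G) : ∃ C : ℕ, ∀ (c : ι → ℤ) (s : ℕ), (∀ i, |c i| ≤ s) →
      (LinearMap.det (∑ i, c i • μ i)).natAbs ≤ C * s ^ Module.finrank ℤ G := by
  classical
  let b := Module.Free.chooseBasis ℤ G
  let n := Module.Free.ChooseBasisIndex ℤ G
  let A : ι → Matrix n n ℤ := fun i => LinearMap.toMatrix b b (μ i)
  obtain ⟨x, hx⟩ : ∃ x : ℕ, ∀ k i j, |A k i j| ≤ x := by
    refine ⟨∑ k, ∑ i, ∑ j, (A k i j).natAbs, fun k i j => ?_⟩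
    rw [Int.abs_eq_natAbs]
    norm_cast
    refine le_trans ?_ (Finset.single_le_sum (f := fun k => ∑ i, ∑ j, (A k i j).natAbs)
      (fun _ _ => Nat.zero_le _) (Finset.mem_univ k))
    refine le_trans ?_ (Finset.single_le_sum (f := fun i => ∑ j, (A k i j).natAbs)
      (fun _ _ => Nat.zero_le _) (Finset.mem_univ i))
    exact Finset.single_le_sum (f := fun j => (A k i j).natAbs)
      (fun _ _ => Nat.zero_le _) (Finset.mem_univ j)
  refine ⟨Nat.factorial (Fintype.card n) * (Fintype.card ι * x) ^ Fintype.card n,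
    fun c s hc => ?_⟩
  have := Matrix.det_sum_smul_le (abv := AbsoluteValue.abs) Finset.univ (c := c) (A := A)
    (x := (x : ℤ)) hx (y := (s : ℤ)) hc
  have e : LinearMap.det (∑ i, c i • μ i) = (∑ i, c i • A i).det := by
    rw [← LinearMap.det_toMatrix b]
    simp only [A, map_sum, map_smul]
  rw [e]
  simp only [AbsoluteValue.abs_apply, Int.abs_eq_natAbs, Finset.card_univ] at this
  rw [Module.finrank_eq_card_chooseBasisIndex]
  have h2 : (∑ i, c i • A i).det.natAbs ≤
      Nat.factorial (Fintype.card n) * (Fintype.card ι * s * x) ^ Fintype.card n := by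
    zify
    simpa using this
  refine h2.trans (le_of_eq ?_)
  rw [mul_right_comm, mul_pow _ s, mul_assoc]

end counting
end JZ

namespace JZ

section simplestep

variable {B : Type*} [Ring B] [Algebra ℚ B] {Λ : Subring B} {V : Type*} [AddCommGroup V]
  [Module B V]

lemma torsionFree_of_alg (B : Type*) [Ring B] [Algebra ℚ B] (V : Type*) [AddCommGroup V]
    [Module B V] : IsAddTorsionFree V := by
  refine ⟨fun n hn x y h => ?_⟩
  have h' : n • x = n • y := h
  rw [← inv_nsmul (B := B) hn x, h', inv_nsmul hn]

/-- the endomorphism `w ↦ ι(w) v` -/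
def fEnd (i : V →ₗ[B] B) : V →+ Module.End B V where
  toFun v := (LinearMap.toSpanSingleton B V v).comp i
  map_zero' := by ext; simp
  map_add' a b := by ext; simp

@[simp] lemma fEnd_apply (i : V →ₗ[B] B) (v w : V) : fEnd i v w = i w • v := rfl

/-- functionals -/
def fT (i : V →ₗ[B] B) (a : B) : V →ₗ[Module.End B V] Module.End B V where
  toFun v := fEnd i (a • v)
  map_add' x y := by simp
  map_smul' c x := by ext; simp

/-- scaling automorphism -/
def scale (n : ℕ) (hn : n ≠ 0) : V ≃ₗ[B] V where
  toFun x := n • x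
  invFun x := (algebraMap ℚ B (n : ℚ)⁻¹) • x
  map_add' x y := by simp
  map_smul' c x := smul_comm n c x
  left_inv x := inv_nsmul hn x
  right_inv x := by
    change n • (algebraMap ℚ B (n : ℚ)⁻¹) • x = x
    rw [smul_comm]
    exact inv_nsmul hn x

/-- the base lattice -/
def baseLat (Λ : Subring B) (i : V →ₗ[B] B) : Submodule Λ V where
  carrier := {v | i v ∈ Λ}
  add_mem' := fun {a b} ha hb => by
    simp only [Set.mem_ofPred_eq, map_add] at *
    exact Λ.add_mem ha hb
  zero_mem' := by simp
  smul_mem' := fun c x hx => by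
    simp only [Set.mem_ofPred_eq, Subring.smul_def, map_smul] at *
    exact Λ.mul_mem c.2 hx

lemma isLat_baseLat (hΛ : Module.Finite ℤ Λ) (hden : ∀ b : B, ∃ n : ℕ, n ≠ 0 ∧ n • b ∈ Λ)
    (i : V →ₗ[B] B) (hi : Function.Injective i) : IsLat (baseLat Λ i) := by
  constructor
  · let φ : baseLat Λ i →+ Λ :=
      { toFun := fun x => ⟨i x, x.2⟩
        map_zero' := by ext; simp
        map_add' := fun a b => by ext; simp }
    refine Module.Finite.of_injective φ.toIntLinearMap ?_
    intro a b hab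
    exact Subtype.ext (hi (congrArg (fun t : Λ => (t : B)) hab))
  · intro v
    obtain ⟨n, hn, h⟩ := hden (i v)
    refine ⟨n, hn, ?_⟩
    change i (n • v) ∈ Λ
    rwa [map_nsmul]

theorem simple_aux [IsSimpleModule B V] [Module ℚ V] [IsScalarTower ℚ B V]
    [FiniteDimensional ℚ V]
    (hden : ∀ b : B, ∃ n : ℕ, n ≠ 0 ∧ n • b ∈ Λ)
    (i : V →ₗ[B] B) (v₀ : V) (hiv : ∀ w, i w • v₀ = w)
    (hM₀ : IsLat (baseLat Λ i)) :
    ∃ C : ℕ, ∀ M : Submodule Λ V, IsLat M → M ≤ baseLat Λ i →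
      ∃ x : Module.End B V, x ≠ 0 ∧ (∀ w ∈ baseLat Λ i, x w ∈ M) ∧
        ∃ D : ℕ, D ≠ 0 ∧ D ≤ C ∧ ∀ y ∈ M, ∃ w ∈ baseLat Λ i, D • y = x w := by
  classical
  have htf : IsAddTorsionFree V := torsionFree_of_alg B V
  have hsm : SMulCommClass B ℚ V := IsScalarTower.to_smulCommClass'
  have hfE : Module.Finite (Module.End B V) V := by
    have : IsScalarTower ℚ (Module.End B V) V := ⟨fun _ _ _ => rfl⟩
    exact Module.Finite.of_restrictScalars_finite ℚ (Module.End B V) V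
  set M₀ := baseLat Λ i with hM₀def
  have hfin0 := hM₀.1
  have hfree0 : Module.Free ℤ M₀ := by
    have : IsAddTorsionFree M₀ := inferInstanceAs (IsAddTorsionFree M₀.toAddSubgroup)
    infer_instance
  -- functionals
  obtain ⟨r, a, hbij⟩ := greedy (A := Λ) (fun a : Λ => fT i (a : B)) (by
    intro v hv
    by_contra hv0
    have h1 : ∀ (b : B) (w : V), i w • b • v = 0 := by
      intro b w
      obtain ⟨n, hn, hb⟩ := hden b
      have := LinearMap.congr_fun (hv ⟨n • b, hb⟩) w
      have h2 : i w • (n • b) • v = 0 := this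
      have h3 : n • (i w • b • v) = 0 := by
        rw [← h2, smul_assoc n b v, smul_comm n]
      exact (nsmul_eq_zero_iff_right hn).1 h3
    obtain ⟨b, hb⟩ := IsSimpleModule.toSpanSingleton_surjective B hv0 v₀
    have hb' : b • v = v₀ := hb
    have := h1 b v
    rw [hb', hiv] at this
    exact hv0 this)
  let E₀ : AddSubgroup (Module.End B V) := M₀.toAddSubgroup.map (fEnd i)
  have hE₀ : ∀ x ∈ E₀, ∀ w ∈ M₀, x w ∈ M₀ := by
    rintro _ ⟨v, hv, rfl⟩ w hw
    exact M₀.smul_mem ⟨i w, hw⟩ hv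
  have hfinE : Module.Finite ℤ E₀ :=
    Module.Finite.of_surjective ((fEnd i).addSubgroupMap M₀.toAddSubgroup).toIntLinearMap
      (AddMonoidHom.addSubgroupMap_surjective _ _)
  have htfEnd : IsAddTorsionFree (Module.End B V) := by
    refine ⟨fun n hn x y h => ?_⟩
    ext v
    exact nsmul_right_injective hn (LinearMap.congr_fun h v)
  have hfreeE : Module.Free ℤ E₀ := inferInstance
  let b := Module.Free.chooseBasis ℤ E₀
  have hE0ne : ∃ x : E₀, x ≠ 0 := by
    have := IsSimpleModule.nontrivial B V
    obtain ⟨v, hv⟩ := exists_ne (0 : V)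
    obtain ⟨n, hn, h⟩ := hM₀.2 v₀
    refine ⟨⟨_, _, h, rfl⟩, fun h0 => hv ?_⟩
    have : fEnd i (n • v₀) v = 0 := LinearMap.congr_fun (congrArg Subtype.val h0) v
    rw [fEnd_apply, smul_comm, hiv] at this
    exact (nsmul_eq_zero_iff_right hn).1 this
  have hne : Nonempty (Module.Free.ChooseBasisIndex ℤ E₀) := by
    have : Nontrivial E₀ := let ⟨x, hx⟩ := hE0ne; ⟨x, 0, hx⟩
    exact b.index_nonempty
  -- the embedding of M₀ in E₀^r
  let τ : M₀ →+ (Fin r → E₀) :=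
    { toFun := fun v k => ⟨fEnd i ((a k : B) • (v : V)), _, M₀.smul_mem (a k) v.2, rfl⟩
      map_zero' := by ext; simp
      map_add' := fun x y => by ext; simp }
  have hτ : Function.Injective τ := by
    intro x y h
    refine Subtype.ext (hbij.1 ?_)
    funext k
    exact congrArg Subtype.val (congrFun h k)
  have hτfin : Finite ((Fin r → E₀) ⧸ τ.range) := by
    refine exists_reps _ fun y => ?_
    obtain ⟨v, hv⟩ := hbij.2 (fun k => (y k : Module.End B V))
    obtain ⟨n, hn, h⟩ := hM₀.2 v
    refine ⟨n, hn, ⟨n • v, h⟩, ?_⟩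
    funext k
    refine Subtype.ext ?_
    have : fEnd i ((a k : B) • v) = y k := congrFun hv k
    change fEnd i ((a k : B) • n • v) = n • (y k : Module.End B V)
    rw [← this, smul_comm, map_nsmul]
  have hcidx : τ.range.index ≠ 0 := Nat.card_pos.ne'
  have hrank : Module.finrank ℤ M₀ ≤ Fintype.card (Module.Free.ChooseBasisIndex ℤ E₀) * r := by
    have := LinearMap.finrank_le_finrank_of_injective (f := τ.toIntLinearMap) hτ
    rw [Module.finrank_pi_fintype] at this
    simp only [Finset.sum_const, Finset.card_univ, Fintype.card_fin, smul_eq_mul] at this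
    rwa [← Module.finrank_eq_card_chooseBasisIndex, mul_comm]
  -- action of E₀ on M₀
  let μ : E₀ →+ Module.End ℤ M₀ :=
    { toFun := fun x => AddMonoidHom.toIntLinearMap
        { toFun := fun w => ⟨(x : Module.End B V) w, hE₀ x x.2 w w.2⟩
          map_zero' := by ext; simp
          map_add' := fun p q => by ext; simp }
      map_zero' := by ext; rfl
      map_add' := fun p q => by ext; rfl }
  obtain ⟨C, hC⟩ := det_bound (fun k => μ (b k))
  refine ⟨C * τ.range.index, fun M hM hMM₀ => ?_⟩
  -- sublattice
  let M' : AddSubgroup M₀ := M.toAddSubgroup.addSubgroupOf M₀.toAddSubgroup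
  let EM : AddSubgroup (Module.End B V) := M.toAddSubgroup.map (fEnd i)
  let H : AddSubgroup E₀ := EM.addSubgroupOf E₀
  have hM'fin : Finite (M₀ ⧸ M') := exists_reps _ fun x => by
    obtain ⟨n, hn, h⟩ := hM.2 x
    exact ⟨n, hn, h⟩
  have hHfin : Finite (E₀ ⧸ H) := exists_reps _ fun x => by
    obtain ⟨_, v, hv, rfl⟩ := x
    obtain ⟨n, hn, h⟩ := hM.2 v
    exact ⟨n, hn, n • v, h, map_nsmul _ _ _⟩
  have hM'idx : M'.index ≠ 0 := Nat.card_pos.ne'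
  have hq : H.index ^ r ≤ M'.index * τ.range.index := by
    have h1 : (M'.map τ).index = M'.index * τ.range.index := by
      rw [AddSubgroup.index_map, (AddMonoidHom.ker_eq_bot_iff τ).2 hτ, sup_bot_eq]
    have h2 : M'.map τ ≤ AddSubgroup.pi Set.univ (fun _ : Fin r => H) := by
      rintro _ ⟨v, hv, rfl⟩ k _
      exact ⟨(a k : B) • (v : V), M.smul_mem (a k) hv, rfl⟩
    have h3 := AddSubgroup.index_dvd_of_le h2
    rw [h1, AddSubgroup.index_pi] at h3
    simp only [Finset.prod_const, Finset.card_univ, Fintype.card_fin] at h3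
    exact Nat.le_of_dvd (Nat.pos_of_ne_zero (mul_ne_zero hM'idx hcidx)) h3
  obtain ⟨s, hs0, hsq, c, hc0, hcs, hcH⟩ := pigeon b H
  let x : E₀ := ∑ k, c k • b k
  have hx0 : (x : Module.End B V) ≠ 0 := by
    intro h
    have h' : ∑ k, c k • b k = 0 := Subtype.ext h
    exact hc0 (funext fun k => Fintype.linearIndependent_iff.1 b.linearIndependent c h' k)
  have hxbij := LinearMap.bijective_of_ne_zero hx0
  have hxM : ∀ w ∈ M₀, (x : Module.End B V) w ∈ M := by
    obtain ⟨v, hv, e⟩ : (x : Module.End B V) ∈ EM := hcH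
    intro w hw
    rw [← e]
    exact M.smul_mem ⟨i w, hw⟩ hv
  have hμx : μ x = ∑ k, c k • μ (b k) := by simp only [x, map_sum, map_zsmul]
  have hinj : Function.Injective (μ x) := fun p q h =>
    Subtype.ext (hxbij.1 (congrArg Subtype.val h))
  let P : AddSubgroup M₀ := (μ x).toAddMonoidHom.range
  have hPidx : P.index ≤ C * τ.range.index * M'.index := by
    have h1 : P.index = (LinearMap.det (μ x)).natAbs := index_range_eq _ hinj
    rw [h1, hμx]
    refine (hC c s hcs).trans ?_
    rw [mul_assoc]
    refine Nat.mul_le_mul_left _ ?_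
    calc s ^ Module.finrank ℤ M₀
        ≤ s ^ (Fintype.card (Module.Free.ChooseBasisIndex ℤ E₀) * r) :=
          Nat.pow_le_pow_right (Nat.pos_of_ne_zero hs0) hrank
      _ = (s ^ Fintype.card (Module.Free.ChooseBasisIndex ℤ E₀)) ^ r := pow_mul _ _ _
      _ ≤ H.index ^ r := Nat.pow_le_pow_left hsq r
      _ ≤ _ := by rw [mul_comm]; exact hq
  have hPM' : P ≤ M' := by
    rintro _ ⟨w, rfl⟩
    exact hxM w w.2
  have hPne : P.index ≠ 0 := by
    have : Finite (M₀ ⧸ P) := exists_reps _ fun w => by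
      obtain ⟨u, hu⟩ := hxbij.2 (w : V)
      obtain ⟨n, hn, h⟩ := hM₀.2 u
      refine ⟨n, hn, ⟨n • u, h⟩, Subtype.ext ?_⟩
      change (x : Module.End B V) (n • u) = n • (w : V)
      rw [map_nsmul, hu]
    exact Nat.card_pos.ne'
  have hmul := AddSubgroup.relIndex_mul_index hPM'
  refine ⟨x, hx0, hxM, P.relIndex M', ?_, ?_, ?_⟩
  · intro h
    rw [h, zero_mul] at hmul
    exact hPne hmul.symm
  · rw [← hmul] at hPidx
    exact Nat.le_of_mul_le_mul_right hPidx (Nat.pos_of_ne_zero hM'idx)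
  · intro y hy
    have : P.relIndex M' • (⟨y, hMM₀ hy⟩ : M₀) ∈ P :=
      (P.addSubgroupOf M').nsmul_index_mem (⟨⟨y, hMM₀ hy⟩, hy⟩ : M')
    obtain ⟨w, hw⟩ := this
    exact ⟨w, w.2, (congrArg Subtype.val hw).symm⟩

theorem JZP_simple [IsSemisimpleRing B] [IsSimpleModule B V] [Module ℚ V] [IsScalarTower ℚ B V]
    [FiniteDimensional ℚ V] (hΛ : Module.Finite ℤ Λ)
    (hden : ∀ b : B, ∃ n : ℕ, n ≠ 0 ∧ n • b ∈ Λ) : JZP Λ V := by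
  have htf : IsAddTorsionFree V := torsionFree_of_alg B V
  have := IsSimpleModule.nontrivial B V
  obtain ⟨v₀, hv₀⟩ := exists_ne (0 : V)
  have := Module.projective_of_isSemisimpleRing B V
  obtain ⟨i, hi⟩ := Module.projective_lifting_property (LinearMap.toSpanSingleton B V v₀)
    LinearMap.id (IsSimpleModule.toSpanSingleton_surjective B hv₀)
  have hiv : ∀ w, i w • v₀ = w := fun w => LinearMap.congr_fun hi w
  have hinj : Function.Injective i := fun x y h => by rw [← hiv x, h, hiv]
  have hM₀ := isLat_baseLat hΛ hden i hinj
  obtain ⟨C, hC⟩ := simple_aux hden i v₀ hiv hM₀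
  refine ⟨_, finite_between (baseLat Λ i) hM₀.1 C.factorial (Nat.factorial_ne_zero C),
    fun M hM => ?_⟩
  have hMf := hM.1
  let Q : AddSubgroup M := (baseLat Λ i).toAddSubgroup.addSubgroupOf M.toAddSubgroup
  have hQ : Finite (M ⧸ Q) := exists_reps _ fun x => by
    obtain ⟨n, hn, h⟩ := hM₀.2 x
    exact ⟨n, hn, h⟩
  have hk : Q.index ≠ 0 := Nat.card_pos.ne'
  let σ : V ≃ₗ[B] V := scale Q.index hk
  have hle : tr σ M ≤ baseLat Λ i := by
    intro y hy
    have h1 : Q.index • (⟨σ.symm y, hy⟩ : M) ∈ Q := Q.nsmul_index_mem _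
    have h2 : Q.index • (σ.symm y) ∈ baseLat Λ i := h1
    have h3 : Q.index • (σ.symm y) = y := σ.apply_symm_apply y
    rwa [h3] at h2
  obtain ⟨x, hx0, hx, D, hD0, hDC, hD⟩ := hC (tr σ M) (hM.tr σ) hle
  let X : V ≃ₗ[B] V := LinearEquiv.ofBijective x (LinearMap.bijective_of_ne_zero hx0)
  refine ⟨σ.trans X.symm, ?_, ?_⟩
  · intro w hw
    rw [← tr_tr]
    exact hx w hw
  · intro y hy
    rw [← tr_tr] at hy
    have hy' : x y ∈ tr σ M := hy
    obtain ⟨w, hw, e⟩ := hD _ hy'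
    have e2 : D • y = w := X.injective (by
      change x (D • y) = x w
      rw [map_nsmul, e])
    obtain ⟨t, ht⟩ := Nat.dvd_factorial (Nat.pos_of_ne_zero hD0) hDC
    rw [ht, mul_comm, mul_smul, e2]
    exact (baseLat Λ i).nsmul_mem hw t

/-- Jordan–Zassenhaus. -/
theorem JZP_all [IsSemisimpleRing B] (hΛ : Module.Finite ℤ Λ)
    (hden : ∀ b : B, ∃ n : ℕ, n ≠ 0 ∧ n • b ∈ Λ) (n : ℕ) :
    ∀ (V : Type*) [AddCommGroup V] [Module B V] [Module ℚ V] [IsScalarTower ℚ B V]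
    [FiniteDimensional ℚ V], Module.finrank ℚ V = n → JZP Λ V := by
  induction n using Nat.strong_induction_on with
  | _ n ih =>
    intro V _ _ _ _ _ hn
    by_cases hV : Subsingleton V
    · refine ⟨{⊤}, Set.finite_singleton _, fun M _ => ⟨LinearEquiv.refl B V, ?_⟩⟩
      have : Subsingleton (Submodule Λ V) := inferInstance
      exact Subsingleton.elim _ _
    · rw [not_subsingleton_iff_nontrivial] at hV
      obtain ⟨W, hW⟩ := IsSemisimpleModule.exists_simple_submodule B V
      obtain ⟨U, hU⟩ := exists_isCompl W
      have hfd : ∀ W : Submodule B V, FiniteDimensional ℚ W := fun W =>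
        Module.Finite.of_injective (W.subtype.restrictScalars ℚ) Subtype.val_injective
      have := hfd W
      have := hfd U
      have hdim : Module.finrank ℚ W + Module.finrank ℚ U = Module.finrank ℚ V := by
        have e : (W × U) ≃ₗ[ℚ] V := (Submodule.prodEquivOfIsCompl W U hU).restrictScalars ℚ
        rw [← e.finrank_eq, Module.finrank_prod]
      have hWpos : 0 < Module.finrank ℚ W := by
        have := IsSimpleModule.nontrivial B W
        exact Module.finrank_pos
      have h1 : JZP Λ W := JZP_simple hΛ hden
      have h2 : JZP Λ U := ih _ (by omega) U rfl
      have := torsionFree_of_alg B W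
      have := torsionFree_of_alg B U
      exact (JZP.prod hden h1 h2).congr (Submodule.prodEquivOfIsCompl W U hU)

end simplestep
end JZ

namespace JZ

section types

theorem finite_types (B : Type*) [Ring B] [Algebra ℚ B] [IsSemisimpleRing B] :
    ∃ (k : ℕ) (S : Fin k → Submodule B B), ∀ (V : Type*) [AddCommGroup V] [Module B V]
      [Module ℚ V] [IsScalarTower ℚ B V] [FiniteDimensional ℚ V],
      ∃ (m : Fin (Module.finrank ℚ V + 1)) (f : Fin m → Fin k),
        Nonempty (V ≃ₗ[B] (∀ j, S (f j))) := by
  classical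
  obtain ⟨k, S, e, hS⟩ := IsSemisimpleModule.exists_linearEquiv_fin_dfinsupp B B
  have hsimp : ∀ (V : Type _) [AddCommGroup V] [Module B V] [IsSimpleModule B V],
      ∃ i, Nonempty (V ≃ₗ[B] S i) := by
    intro V _ _ _
    have := IsSimpleModule.nontrivial B V
    obtain ⟨v, hv⟩ := exists_ne (0 : V)
    let φ : B →ₗ[B] V := LinearMap.toSpanSingleton B V v
    let ψ : (Π₀ i : Fin k, S i) →ₗ[B] V := φ.comp e.symm.toLinearMap
    have hψ : ψ ≠ 0 := by
      intro h
      apply hv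
      have := LinearMap.congr_fun h (e 1)
      simpa [ψ, φ] using this
    have : ∃ i, ψ.comp (DFinsupp.lsingle i) ≠ 0 := by
      by_contra hcon
      push Not at hcon
      apply hψ
      exact DFinsupp.lhom_ext' fun i => by rw [hcon i, LinearMap.zero_comp]
    obtain ⟨i, hi⟩ := this
    have := hS i
    exact ⟨i, ⟨(LinearEquiv.ofBijective _ (LinearMap.bijective_of_ne_zero hi)).symm⟩⟩
  refine ⟨k, S, ?_⟩
  intro V _ _ _ _ _
  have : Module.Finite B V := Module.Finite.of_restrictScalars_finite ℚ B V
  obtain ⟨m, T, eV, hT⟩ := IsSemisimpleModule.exists_linearEquiv_fin_dfinsupp B V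
  have hfd : ∀ W : Submodule B V, FiniteDimensional ℚ W := fun W =>
    Module.Finite.of_injective (W.subtype.restrictScalars ℚ) Subtype.val_injective
  choose f hf using fun j => hsimp (T j)
  let e' : V ≃ₗ[B] (∀ j, T j) := eV.trans DFinsupp.linearEquivFunOnFintype
  have hm : m ≤ Module.finrank ℚ V := by
    rw [(e'.restrictScalars ℚ).finrank_eq, Module.finrank_pi_fintype]
    calc m = ∑ _j : Fin m, 1 := by simp
      _ ≤ _ := Finset.sum_le_sum fun j _ => by
        have := IsSimpleModule.nontrivial B (T j)
        exact Module.finrank_pos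
  exact ⟨⟨m, Nat.lt_succ_of_le hm⟩, f,
    ⟨e'.trans (LinearEquiv.piCongrRight fun j => (hf j).some)⟩⟩

end types

section tensor
open scoped TensorProduct

theorem tens_smul {k A L : Type*} [Field k] [Ring A] [Algebra k A] [Field L] [Algebra k L]
    (a : A) (x : A ⊗[k] L) : a • x = (a ⊗ₜ[k] (1 : L)) * x := by
  induction x with
  | zero => simp
  | tmul b l => simp [TensorProduct.smul_tmul']
  | add x y hx hy => rw [smul_add, mul_add, hx, hy]

theorem semisimple_tensor (k A L : Type*) [Field k] [Ring A] [Algebra k A] [Field L] [Algebra k L]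
    [FiniteDimensional k L] [Algebra.IsSeparable k L] [IsSemisimpleRing A] :
    IsSemisimpleRing (A ⊗[k] L) := by
  have hunr : Algebra.FormallyUnramified k L := Algebra.FormallyUnramified.of_isSeparable k L
  obtain ⟨t, ht1, ht2⟩ := (Algebra.FormallyUnramified.iff_exists_tensorProduct (R := k)
    (S := L)).1 hunr
  refine { exists_isCompl := fun W => ?_ }
  -- an `A`-linear projection onto `W`
  let WA : Submodule A (A ⊗[k] L) :=
    { carrier := W
      add_mem' := fun ha hb => W.add_mem ha hb
      zero_mem' := W.zero_mem
      smul_mem' := fun c x hx => by rw [tens_smul]; exact W.smul_mem _ hx }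
  obtain ⟨W', hW'⟩ := exists_isCompl WA
  obtain ⟨π, hπ1, hπ2⟩ : ∃ π : (A ⊗[k] L) →ₗ[A] (A ⊗[k] L), (∀ x, π x ∈ W) ∧
      ∀ x ∈ W, π x = x := by
    refine ⟨WA.subtype ∘ₗ WA.projectionOnto W' hW', fun x => ?_, fun x hx => ?_⟩
    · exact (WA.projectionOnto W' hW' x).2
    · have := Submodule.projectionOnto_apply_left hW' ⟨x, hx⟩
      simpa using congrArg Subtype.val this
  let p : Module.End k (A ⊗[k] L) := π.restrictScalars k
  have hp : ∀ x, p x = π x := fun x => rfl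
  let lam : L →ₗ[k] Module.End k (A ⊗[k] L) :=
    (LinearMap.mul k (A ⊗[k] L)) ∘ₗ
      (Algebra.TensorProduct.includeRight (R := k) (A := A) (B := L)).toLinearMap
  have hlam : ∀ l x, lam l x = ((1 : A) ⊗ₜ[k] l) * x := fun l x => rfl
  let Φ : L ⊗[k] L →ₗ[k] Module.End k (A ⊗[k] L) :=
    TensorProduct.lift ((LinearMap.mul k (Module.End k (A ⊗[k] L))).compl₁₂ lam
      (LinearMap.mulLeft k p ∘ₗ lam))
  have hΦ : ∀ l l' x, Φ (l ⊗ₜ l') x = (1 ⊗ₜ l) * π ((1 ⊗ₜ l') * x) := fun l l' x => rfl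
  have h1 : ∀ t x, Φ t x ∈ W := by
    intro t x
    induction t with
    | zero => simp
    | tmul l l' => rw [hΦ]; exact W.smul_mem _ (hπ1 _)
    | add a b ha hb => rw [map_add]; exact W.add_mem ha hb
  have h2 : ∀ t, ∀ x ∈ W, Φ t x = (1 ⊗ₜ (Algebra.TensorProduct.lmul' k t)) * x := by
    intro t x hx
    induction t with
    | zero => simp
    | tmul l l' =>
      rw [hΦ, hπ2 ((1 ⊗ₜ l') * x) (W.smul_mem _ hx), ← mul_assoc]
      simp
    | add a b ha hb => simp [map_add, TensorProduct.tmul_add, add_mul, ha, hb]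
  have h3 : ∀ t (a : A) x, Φ t ((a ⊗ₜ 1) * x) = (a ⊗ₜ 1) * Φ t x := by
    intro t a x
    induction t with
    | zero => simp
    | tmul l l' =>
      rw [hΦ, hΦ]
      have : ((1 : A) ⊗ₜ[k] l') * (a ⊗ₜ 1 * x) = a • ((1 ⊗ₜ l') * x) := by
        rw [tens_smul, ← mul_assoc, ← mul_assoc]; simp
      rw [this, map_smul, tens_smul, ← mul_assoc, ← mul_assoc]; simp
    | add u v hu hv => simp [map_add, mul_add, hu, hv]
  have h4 : ∀ t (s : L) x, Φ ((1 ⊗ₜ s) * t) x = Φ t ((1 ⊗ₜ s) * x) := by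
    intro t s x
    induction t with
    | zero => simp
    | tmul l l' =>
      rw [Algebra.TensorProduct.tmul_mul_tmul, hΦ, hΦ, ← mul_assoc]; simp [mul_comm]
    | add u v hu hv => simp [map_add, mul_add, hu, hv]
  have h5 : ∀ t (s : L) x, Φ ((s ⊗ₜ 1) * t) x = (1 ⊗ₜ s) * Φ t x := by
    intro t s x
    induction t with
    | zero => simp
    | tmul l l' =>
      rw [Algebra.TensorProduct.tmul_mul_tmul, hΦ, hΦ, ← mul_assoc]; simp
    | add u v hu hv => simp [map_add, mul_add, hu, hv]
  have h6 : ∀ (s : L) x, Φ t ((1 ⊗ₜ s) * x) = (1 ⊗ₜ s) * Φ t x := by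
    intro s x
    rw [← h4, ← h5]
    have := ht1 s
    rw [sub_mul, sub_eq_zero] at this
    rw [this]
  have h7 : ∀ (b x : A ⊗[k] L), Φ t (b * x) = b * Φ t x := by
    intro b x
    induction b with
    | zero => simp
    | tmul a s =>
      have : a ⊗ₜ[k] s = (a ⊗ₜ 1) * (1 ⊗ₜ s) := by simp
      rw [this, mul_assoc, h3, h6, mul_assoc]
    | add u v hu hv => simp [map_add, add_mul, hu, hv]
  let F : (A ⊗[k] L) →ₗ[A ⊗[k] L] W :=
    { toFun := fun x => ⟨Φ t x, h1 t x⟩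
      map_add' := fun x y => Subtype.ext (map_add _ _ _)
      map_smul' := fun b x => Subtype.ext (h7 b x) }
  refine ⟨_, LinearMap.isCompl_of_proj (f := F) fun x => Subtype.ext ?_⟩
  change Φ t x = x
  rw [h2 t x x.2]
  have : Algebra.TensorProduct.lmul' k t = 1 := ht2
  rw [this, ← Algebra.TensorProduct.one_def, one_mul]

end tensor
end JZ

namespace JZ

theorem finite_of_lattices {B : Type*} [Ring B] [Algebra ℚ B] [IsSemisimpleRing B]
    [FiniteDimensional ℚ B] {Λ : Subring B}
    (hΛ : Module.Finite ℤ Λ) (hden : ∀ b : B, ∃ n : ℕ, n ≠ 0 ∧ n • b ∈ Λ)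
    {P : Type*} (V : P → Type*) [∀ ρ, AddCommGroup (V ρ)] [∀ ρ, Module B (V ρ)]
    [∀ ρ, Module ℚ (V ρ)] [∀ ρ, IsScalarTower ℚ B (V ρ)] [∀ ρ, FiniteDimensional ℚ (V ρ)]
    (M : ∀ ρ, Submodule Λ (V ρ)) (hM : ∀ ρ, IsLat (M ρ)) (d : ℕ)
    (hd : ∀ ρ, Module.finrank ℚ (V ρ) = d) (r : P → P → Prop)
    (hr : ∀ ρ ρ' (g : V ρ ≃ₗ[B] V ρ'), tr g (M ρ) = M ρ' → r ρ ρ') : Finite (Quot r) := by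
  classical
  obtain ⟨k, S, hS⟩ := finite_types B
  have hfd : ∀ i, FiniteDimensional ℚ (S i) := fun i =>
    Module.Finite.of_injective ((S i).subtype.restrictScalars ℚ) Subtype.val_injective
  have hJ : ∀ (m : Fin (d + 1)) (f : Fin m → Fin k), JZP Λ (∀ j, S (f j)) := fun m f =>
    JZP_all hΛ hden _ _ rfl
  choose T hTfin hT using hJ
  have key : ∀ ρ, ∃ x : (Σ (m : Fin (d + 1)) (f : Fin m → Fin k), T m f),
      ∃ g : V ρ ≃ₗ[B] (∀ j, S (x.2.1 j)), tr g (M ρ) = x.2.2.1 := by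
    intro ρ
    obtain ⟨m, f, ⟨e⟩⟩ := hS (V ρ)
    have hm : (m : ℕ) < d + 1 := by rw [← hd ρ]; exact m.2
    obtain ⟨g, hg⟩ := hT ⟨m, hm⟩ f (tr e (M ρ)) ((hM ρ).tr e)
    rw [tr_tr] at hg
    exact ⟨⟨⟨m, hm⟩, f, ⟨_, hg⟩⟩, e.trans g, rfl⟩
  choose F G hG using key
  have : ∀ m f, Finite (T m f) := fun m f => (hTfin m f).to_subtype
  have hinj : ∀ ρ ρ', F ρ = F ρ' → r ρ ρ' := by
    intro ρ ρ' h
    obtain ⟨g, hg⟩ : ∃ g : V ρ ≃ₗ[B] (∀ j, S ((F ρ').2.1 j)), tr g (M ρ) = (F ρ').2.2.1 := by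
      rw [← h]; exact ⟨G ρ, hG ρ⟩
    apply hr ρ ρ' (g.trans (G ρ').symm)
    rw [← tr_tr, hg, ← hG ρ', tr_tr]
    ext y
    simp [mem_tr]
  refine Finite.of_injective (fun q : Quot r => F q.out) fun q q' h => ?_
  rw [← Quot.out_eq q, ← Quot.out_eq q']
  exact Quot.sound (hinj _ _ h)

end JZ

namespace JZ

section VM
variable {A L : Type*} [Ring A] [Algebra ℚ A] [Field L] [Algebra ℚ L]

/-- The module `A` with right multiplication by `A` and left multiplication through `ρ`. -/
def VM (_ρ : L →ₐ[ℚ] A) : Type _ := A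

instance (ρ : L →ₐ[ℚ] A) : AddCommGroup (VM ρ) := inferInstanceAs (AddCommGroup A)
instance (ρ : L →ₐ[ℚ] A) : Module ℚ (VM ρ) := inferInstanceAs (Module ℚ A)
instance [FiniteDimensional ℚ A] (ρ : L →ₐ[ℚ] A) : FiniteDimensional ℚ (VM ρ) :=
  inferInstanceAs (FiniteDimensional ℚ A)

/-- The action of `Aᵐᵒᵖ ⊗ L`. -/
noncomputable def act (ρ : L →ₐ[ℚ] A) : Aᵐᵒᵖ ⊗[ℚ] L →ₐ[ℚ] Module.End ℚ A :=
  Algebra.TensorProduct.lift (Algebra.lsmul ℚ ℚ A : Aᵐᵒᵖ →ₐ[ℚ] Module.End ℚ A)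
    ((Algebra.lmul ℚ A).comp ρ) (by
      intro a l
      apply LinearMap.ext
      intro x
      simp [mul_assoc])

theorem act_tmul (ρ : L →ₐ[ℚ] A) (a : A) (l : L) (x : A) :
    act ρ (MulOpposite.op a ⊗ₜ l) x = ρ l * x * a := by
  have h : act ρ (MulOpposite.op a ⊗ₜ l) =
      (Algebra.lsmul ℚ ℚ A (MulOpposite.op a)) * ((Algebra.lmul ℚ A).comp ρ) l :=
    Algebra.TensorProduct.lift_tmul _ _ _ _ _
  rw [h]
  rfl

noncomputable instance (ρ : L →ₐ[ℚ] A) : Module (Aᵐᵒᵖ ⊗[ℚ] L) (VM ρ) :=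
  Module.compHom A (act ρ).toRingHom

theorem VM_smul (ρ : L →ₐ[ℚ] A) (b : Aᵐᵒᵖ ⊗[ℚ] L) (x : VM ρ) :
    b • x = (act ρ b (show A from x) : A) := rfl

instance (ρ : L →ₐ[ℚ] A) : IsScalarTower ℚ (Aᵐᵒᵖ ⊗[ℚ] L) (VM ρ) where
  smul_assoc q b x := by
    rw [VM_smul, VM_smul, map_smul]
    rfl

end VM

section ext
variable {A L : Type*} [Ring A] [Algebra ℚ A] [Field L] [Algebra ℚ L]

theorem den_of_span (Γ : Subring L) (hΓspan : Submodule.span ℚ (Γ : Set L) = ⊤) (x : L) :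
    ∃ n : ℕ, n ≠ 0 ∧ n • x ∈ Γ := by
  have hx : x ∈ Submodule.span ℚ (Γ : Set L) := by rw [hΓspan]; trivial
  induction hx using Submodule.span_induction with
  | mem x h => exact ⟨1, one_ne_zero, by simpa using h⟩
  | zero => exact ⟨1, one_ne_zero, by simp⟩
  | add x y _ _ hx hy =>
    obtain ⟨n, hn, hx⟩ := hx
    obtain ⟨m, hm, hy⟩ := hy
    refine ⟨m * n, mul_ne_zero hm hn, ?_⟩
    have : (m * n) • (x + y) = m • (n • x) + n • (m • y) := by
      rw [smul_add, mul_smul, mul_comm m n, mul_smul]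
    rw [this]
    exact Γ.add_mem (Γ.nsmul_mem hx _) (Γ.nsmul_mem hy _)
  | smul q x _ hx =>
    obtain ⟨n, hn, hx⟩ := hx
    refine ⟨n * q.den, mul_ne_zero hn q.den_nz, ?_⟩
    have : (n * q.den) • (q • x) = q.num • (n • x) := by
      rw [← Nat.cast_smul_eq_nsmul ℚ, ← Nat.cast_smul_eq_nsmul ℚ, ← Int.cast_smul_eq_zsmul ℚ,
        smul_smul, smul_smul]
      congr 1
      have := Rat.mul_den_eq_num q
      push_cast
      rw [← this]; ring
    rw [this]
    exact Γ.zsmul_mem hx _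

theorem exists_ext (Γ : Subring L) (hΓspan : Submodule.span ℚ (Γ : Set L) = ⊤) (σ : Γ →+* A) :
    ∃ ρ : L →ₐ[ℚ] A, ∀ γ : Γ, ρ γ = σ γ := by
  have hden := den_of_span Γ hΓspan
  choose n hn hnx using hden
  have qn : ∀ {m : ℕ}, m ≠ 0 → (m : ℚ) ≠ 0 := fun h => Nat.cast_ne_zero.2 h
  -- the value does not depend on the denominator
  let F : L → A := fun x => (n x : ℚ)⁻¹ • σ ⟨n x • x, hnx x⟩
  have hF : ∀ (x : L) (m : ℕ) (γ : Γ), m ≠ 0 → m • x = γ → F x = (m : ℚ)⁻¹ • σ γ := by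
    intro x m γ hm h
    have h1 : m • (⟨n x • x, hnx x⟩ : Γ) = n x • γ := by
      apply Subtype.ext
      push_cast
      rw [← h, smul_comm]
    have h2 := congrArg σ h1
    rw [map_nsmul, map_nsmul, ← Nat.cast_smul_eq_nsmul ℚ m, ← Nat.cast_smul_eq_nsmul ℚ (n x) (σ γ)]
      at h2
    change (n x : ℚ)⁻¹ • σ ⟨n x • x, hnx x⟩ = _
    rw [inv_smul_eq_iff₀ (qn (hn x)), smul_comm, ← h2, inv_smul_smul₀ (qn hm)]
  have hone : F 1 = 1 := by
    rw [hF 1 1 1 one_ne_zero (by simp)]; simp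
  have hadd : ∀ x y, F (x + y) = F x + F y := by
    intro x y
    have hx := hF x (n x * n y) (n y • ⟨n x • x, hnx x⟩) (mul_ne_zero (hn x) (hn y))
      (by push_cast; rw [mul_comm, mul_smul])
    have hy := hF y (n x * n y) (n x • ⟨n y • y, hnx y⟩) (mul_ne_zero (hn x) (hn y))
      (by push_cast; rw [mul_smul])
    rw [hx, hy, ← smul_add, ← map_add]
    apply hF _ _ _ (mul_ne_zero (hn x) (hn y))
    push_cast
    rw [smul_add]; congr 1
    · rw [mul_comm, mul_smul]
    · rw [mul_smul]
  have hmul : ∀ x y, F (x * y) = F x * F y := by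
    intro x y
    rw [hF (x * y) (n x * n y) (⟨n x • x, hnx x⟩ * ⟨n y • y, hnx y⟩)
      (mul_ne_zero (hn x) (hn y)) (by push_cast; rw [smul_mul_smul_comm])]
    change _ = ((n x : ℚ)⁻¹ • σ ⟨n x • x, hnx x⟩) * ((n y : ℚ)⁻¹ • σ ⟨n y • y, hnx y⟩)
    rw [smul_mul_smul_comm, map_mul]
    push_cast
    rw [mul_inv]
  let G : L →+* A :=
    { toFun := F
      map_one' := hone
      map_mul' := hmul
      map_zero' := by
        have := hadd 0 0
        simpa using this
      map_add' := hadd }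
  refine ⟨G.toRatAlgHom, fun γ => ?_⟩
  change F γ = _
  rw [hF γ 1 γ one_ne_zero (by simp)]; simp

end ext

section core

theorem lattice_subring {B R' G : Type*} [Ring B] [Ring R'] [CommRing G]
    [Module.Finite ℤ R'] [Module.Finite ℤ G]
    (f : R' →+* B) (g : G →+* B) (hc : ∀ r x, Commute (f r) (g x)) :
    ∃ Λ : Subring B, Module.Finite ℤ Λ ∧ (∀ r x, f r * g x ∈ Λ) ∧
      ∀ y ∈ Λ, y ∈ AddSubgroup.closure {b | ∃ r x, f r * g x = b} := by
  let φ : R' ⊗[ℤ] G →ₐ[ℤ] B :=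
    Algebra.TensorProduct.lift f.toIntAlgHom g.toIntAlgHom hc
  have hφ : ∀ r x, φ (r ⊗ₜ x) = f r * g x := fun r x =>
    Algebra.TensorProduct.lift_tmul _ _ _ _ _
  refine ⟨φ.toRingHom.range, ?_, fun r x => ⟨r ⊗ₜ x, hφ r x⟩, ?_⟩
  · let F : R' ⊗[ℤ] G →ₗ[ℤ] φ.toRingHom.range :=
      { toFun := φ.toRingHom.rangeRestrict
        map_add' := map_add _
        map_smul' := fun n x => Subtype.ext (by
          change φ (n • x) = n • φ x
          exact map_smul φ n x) }
    have hfin := Module.Finite.tensorProduct ℤ R' G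
    refine @Module.Finite.of_surjective _ _ _ _ _ _ _ _ _ _ _ ?_ F
      φ.toRingHom.rangeRestrict_surjective
    have e : AddCommGroup.toIntModule (R' ⊗[ℤ] G) = TensorProduct.instModule :=
      Subsingleton.elim _ _
    rw [e]
    exact hfin
  · rintro _ ⟨t, rfl⟩
    change φ t ∈ _
    induction t with
    | zero => rw [map_zero]; exact zero_mem _
    | tmul r x => exact AddSubgroup.subset_closure ⟨r, x, (hφ r x).symm⟩
    | add u v hu hv => rw [map_add]; exact add_mem hu hv

theorem core {A L R : Type*} [Ring A] [Algebra ℚ A] [FiniteDimensional ℚ A] [IsSemisimpleRing A]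
    [Field L] [NumberField L] (Γ : Subring L) (hΓfin : Module.Finite ℤ Γ)
    (hΓspan : Submodule.span ℚ (Γ : Set L) = ⊤) [Ring R] (hRfin : Module.Finite ℤ R)
    (j : R →+* A) (hj : Function.Injective j)
    (hjden : ∀ a : A, ∃ n : ℕ, n ≠ 0 ∧ ∃ x, j x = n • a) :
    Finite (Quot (ConjRel Γ R)) := by
  have hB : IsSemisimpleRing (Aᵐᵒᵖ ⊗[ℚ] L) := semisimple_tensor ℚ Aᵐᵒᵖ L
  have hAo : FiniteDimensional ℚ Aᵐᵒᵖ :=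
    Module.Finite.equiv (MulOpposite.opLinearEquiv ℚ : A ≃ₗ[ℚ] Aᵐᵒᵖ)
  have hRo : Module.Finite ℤ Rᵐᵒᵖ :=
    Module.Finite.equiv (MulOpposite.opLinearEquiv ℤ : R ≃ₗ[ℤ] Rᵐᵒᵖ)
  have hmulB : ∀ (a : Aᵐᵒᵖ) (l : L), (a ⊗ₜ[ℚ] (1 : L)) * (1 ⊗ₜ l) = a ⊗ₜ l := by
    intro a l; simp
  obtain ⟨Λ, hΛ, hΛ1, hΛ2⟩ := lattice_subring
    ((Algebra.TensorProduct.includeLeft : Aᵐᵒᵖ →ₐ[ℚ] Aᵐᵒᵖ ⊗[ℚ] L).toRingHom.comp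
        (RingHom.op j))
    ((Algebra.TensorProduct.includeRight : L →ₐ[ℚ] Aᵐᵒᵖ ⊗[ℚ] L).toRingHom.comp
        Γ.subtype)
    (by
      intro r γ
      change ((_ : Aᵐᵒᵖ) ⊗ₜ[ℚ] (1 : L)) * (1 ⊗ₜ _) = (1 ⊗ₜ _) * (_ ⊗ₜ 1)
      simp)
  replace hΛ1 : ∀ (r : R) (γ : Γ), MulOpposite.op (j r) ⊗ₜ (γ : L) ∈ Λ := by
    intro r γ
    rw [← hmulB]
    exact hΛ1 (MulOpposite.op r) γ
  have hden : ∀ b : Aᵐᵒᵖ ⊗[ℚ] L, ∃ n : ℕ, n ≠ 0 ∧ n • b ∈ Λ := by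
    intro b
    induction b with
    | zero => exact ⟨1, one_ne_zero, by simp⟩
    | tmul a l =>
      obtain ⟨n, hn, x, hx⟩ := hjden a.unop
      obtain ⟨m, hm, hl⟩ := den_of_span Γ hΓspan l
      refine ⟨n * m, mul_ne_zero hn hm, ?_⟩
      have h := hΛ1 x ⟨m • l, hl⟩
      rw [hx, MulOpposite.op_smul, MulOpposite.op_unop] at h
      rw [mul_smul, ← TensorProduct.tmul_smul, TensorProduct.smul_tmul']
      exact h
    | add x y hx hy =>
      obtain ⟨n, hn, hx⟩ := hx
      obtain ⟨m, hm, hy⟩ := hy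
      refine ⟨m * n, mul_ne_zero hm hn, ?_⟩
      have : (m * n) • (x + y) = m • (n • x) + n • (m • y) := by
        rw [smul_add, mul_smul, mul_comm m n, mul_smul]
      rw [this]
      exact Λ.add_mem (Λ.nsmul_mem hx _) (Λ.nsmul_mem hy _)
  choose ext hext using fun ρ : Γ →+* R => exists_ext Γ hΓspan (j.comp ρ)
  let M : ∀ ρ : Γ →+* R, Submodule Λ (VM (ext ρ)) := fun ρ =>
    { carrier := {x : A | ∃ r, j r = x}
      add_mem' := by
        rintro _ _ ⟨a, rfl⟩ ⟨b, rfl⟩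
        exact ⟨a + b, map_add _ _ _⟩
      zero_mem' := ⟨0, map_zero _⟩
      smul_mem' := by
        rintro ⟨t, ht⟩ x ⟨r, hr⟩
        change ∃ s, j s = act (ext ρ) t x
        rw [← hr]
        have ht' := hΛ2 t ht
        clear ht
        induction ht' using AddSubgroup.closure_induction with
        | mem y hy =>
          obtain ⟨a, γ, rfl⟩ := hy
          refine ⟨ρ γ * r * a.unop, ?_⟩
          change _ = act (ext ρ) ((MulOpposite.op (j a.unop) ⊗ₜ[ℚ] (1 : L)) * (1 ⊗ₜ (γ : L))) (j r)
          rw [hmulB, act_tmul, hext]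
          simp
        | zero => exact ⟨0, by simp⟩
        | add u v _ _ hu hv =>
          obtain ⟨s, hs⟩ := hu
          obtain ⟨s', hs'⟩ := hv
          exact ⟨s + s', by rw [map_add, map_add, hs, hs']; rfl⟩
        | neg u _ hu =>
          obtain ⟨s, hs⟩ := hu
          exact ⟨-s, by rw [map_neg, map_neg, hs]; rfl⟩ }
  refine finite_of_lattices hΛ hden (fun ρ : Γ →+* R => VM (ext ρ)) M (fun ρ => ⟨?_, ?_⟩)
    (Module.finrank ℚ A) (fun ρ => rfl) (ConjRel Γ R) ?_
  · let F : R →+ M ρ :=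
      { toFun := fun r => ⟨j r, r, rfl⟩
        map_zero' := Subtype.ext (map_zero j)
        map_add' := fun a b => Subtype.ext (map_add j a b) }
    refine Module.Finite.of_surjective F.toIntLinearMap ?_
    rintro ⟨_, r, rfl⟩
    exact ⟨r, rfl⟩
  · intro v
    obtain ⟨n, hn, x, hx⟩ := hjden v
    exact ⟨n, hn, x, hx⟩
  · intro ρ ρ' g hg
    let f : A → A := g
    let f' : A → A := g.symm
    have hff' : ∀ x, f (f' x) = x := fun x => g.apply_symm_apply x
    have hf'f : ∀ x, f' (f x) = x := fun x => g.symm_apply_apply x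
    have hf : ∀ a l x, f (ext ρ l * x * a) = ext ρ' l * f x * a := by
      intro a l x
      have := g.map_smul (MulOpposite.op a ⊗ₜ l) (show VM (ext ρ) from x)
      rw [VM_smul, VM_smul] at this
      have h1 := act_tmul (ext ρ) a l x
      have h2 := act_tmul (ext ρ') a l (f x)
      rw [← h1, ← h2]
      exact this
    have hfr : ∀ x, f x = f 1 * x := by
      intro x
      have := hf x 1 1
      simpa using this
    have hf'r : ∀ x, f' x = f' 1 * x := by
      intro x
      have h := hfr (f' 1 * x)
      rw [← mul_assoc, ← hfr, hff', one_mul] at h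
      rw [← h, hf'f, h]
    have hm : ∀ x, (∃ r, j r = f' x) ↔ ∃ r, j r = x := by
      intro x
      have h1 : (show VM (ext ρ') from x) ∈ tr g (M ρ) ↔ (show VM (ext ρ') from x) ∈ M ρ' := by
        rw [hg]
      exact (mem_tr g (M ρ) _).symm.trans h1
    obtain ⟨u, hu⟩ := (hm (f 1)).1 ⟨1, by rw [hf'f, map_one]⟩
    obtain ⟨v, hv⟩ := (hm 1).2 ⟨1, map_one j⟩
    have huv : u * v = 1 := hj (by rw [map_mul, hu, hv, ← hfr, hff', map_one])
    have hvu : v * u = 1 := hj (by rw [map_mul, hu, hv, ← hf'r, hf'f, map_one])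
    refine ⟨⟨u, v, huv, hvu⟩, fun γ => ?_⟩
    change ρ' γ = u * ρ γ * v
    have key : ρ' γ * u = u * ρ γ := by
      apply hj
      rw [map_mul, map_mul, hu, ← hfr]
      have h := hf 1 γ 1
      rw [hext, hext] at h
      simpa using h.symm
    rw [← key, mul_assoc, huv, mul_one]

end core

theorem main (L : Type*) [Field L] [NumberField L]
    (Γ : Subring L) (hΓfin : Module.Finite ℤ Γ)
    (hΓspan : Submodule.span ℚ (Γ : Set L) = ⊤)
    (R : Type*) [Ring R] (hRfin : Module.Finite ℤ R)
    (hRtf : NoZeroSMulDivisors ℤ R)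
    (hss : IsSemisimpleRing (R ⊗[ℤ] ℚ)) :
    Finite (Quot (ConjRel Γ R)) := by
  let _ : Algebra ℚ (R ⊗[ℤ] ℚ) :=
    (Algebra.TensorProduct.includeRight : ℚ →ₐ[ℤ] R ⊗[ℤ] ℚ).toRingHom.toAlgebra' (by
      intro q x
      change (1 ⊗ₜ q) * x = x * (1 ⊗ₜ q)
      induction x with
      | zero => simp
      | tmul r p => simp [mul_comm]
      | add x y hx hy => rw [mul_add, add_mul, hx, hy])
  have hsm : ∀ (q : ℚ) (x : R ⊗[ℤ] ℚ), q • x = (1 ⊗ₜ q) * x := fun q x => Algebra.smul_def q x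
  have hfd : FiniteDimensional ℚ (R ⊗[ℤ] ℚ) := by
    obtain ⟨s, hs⟩ := hRfin
    classical
    refine ⟨⟨s.image fun r => r ⊗ₜ[ℤ] (1 : ℚ), ?_⟩⟩
    rw [eq_top_iff]
    intro x _
    induction x with
    | zero => exact Submodule.zero_mem _
    | tmul r p =>
      rw [show r ⊗ₜ[ℤ] p = p • (r ⊗ₜ[ℤ] (1 : ℚ)) by rw [hsm]; simp]
      apply Submodule.smul_mem
      have hr : r ∈ Submodule.span ℤ (s : Set R) := by rw [hs]; trivial
      induction hr using Submodule.span_induction with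
      | mem r hr => exact Submodule.subset_span (by simpa using ⟨r, hr, rfl⟩)
      | zero => simp
      | add x y _ _ hx hy =>
        rw [TensorProduct.add_tmul]
        exact Submodule.add_mem _ (hx trivial) (hy trivial)
      | smul n x _ hx =>
        rw [← TensorProduct.smul_tmul']
        exact zsmul_mem (hx trivial) n
    | add x y hx hy => exact Submodule.add_mem _ (hx trivial) (hy trivial)
  have hflat : Module.Flat ℤ R := inferInstance
  refine core (A := R ⊗[ℤ] ℚ) Γ hΓfin hΓspan hRfin
    (Algebra.TensorProduct.includeLeft : R →ₐ[ℤ] R ⊗[ℤ] ℚ).toRingHom ?_ ?_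
  · exact Algebra.TensorProduct.includeLeft_injective (S := ℤ) Int.cast_injective
  · intro a
    change ∃ n : ℕ, n ≠ 0 ∧ ∃ x : R, x ⊗ₜ[ℤ] (1 : ℚ) = n • a
    induction a with
    | zero => exact ⟨1, one_ne_zero, 0, by simp⟩
    | tmul r p =>
      refine ⟨p.den, p.den_nz, p.num • r, ?_⟩
      rw [TensorProduct.smul_tmul, ← TensorProduct.tmul_smul]
      congr 1
      have := Rat.mul_den_eq_num p
      rw [zsmul_eq_mul, nsmul_eq_mul, mul_one, ← this, mul_comm]
    | add x y hx hy =>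
      obtain ⟨n, hn, u, hx⟩ := hx
      obtain ⟨m, hm, v, hy⟩ := hy
      refine ⟨m * n, mul_ne_zero hm hn, m • u + n • v, ?_⟩
      have : (m * n) • (x + y) = m • (n • x) + n • (m • y) := by
        rw [smul_add, mul_smul, mul_comm m n, mul_smul]
      rw [this, TensorProduct.add_tmul, ← hx, ← hy, TensorProduct.smul_tmul',
        TensorProduct.smul_tmul']

end JZ

/-- Let `Γ` be an order of a number field `L`, and let `R` be an
associative unital ring whose underlying `ℤ`-module is finitely generated and
torsion-free, and such that the `ℚ`-algebra `R ⊗_ℤ ℚ` is semisimple.  Then there are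
only finitely many `Γ`-structures on `R`: the set of unital ring homomorphisms `Γ → R`
modulo conjugation by units of `R` is finite. -/
theorem finite_gammaStructures
    (L : Type*) [Field L] [NumberField L]
    (Γ : Subring L) (hΓfin : Module.Finite ℤ Γ)
    (hΓspan : Submodule.span ℚ (Γ : Set L) = ⊤)
    (R : Type*) [Ring R] (hRfin : Module.Finite ℤ R)
    (hRtf : NoZeroSMulDivisors ℤ R)
    (hss : IsSemisimpleRing (R ⊗[ℤ] ℚ)) :
    Finite (Quot (ConjRel Γ R)) :=
  JZ.main L Γ hΓfin hΓspan R hRfin hRtf hss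
end
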